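/- arXiv:1006.1410 — 2 statements merged into one kernel-verified Lean document; each statement's English description precedes it below -/
import Mathlib

section
/- If W_i is the winning region of Player i in a Muller game (G, 𝓕₀, 𝓕₁), and W_i' is the winning region of Player i in McNaughton's finite-time Muller game on (G, 𝓕₀, 𝓕₁), in which a play is stopped and won by Player j as soon as some set F with F ∈ 𝓕_j reaches score |F|! + 1, then W_i = W_i' for both players i ∈ {0,1}. -/
/- Common definitions for finite-time Muller games, following
   McNaughton / Fearnley-Zimmermann. -/

universe u

variable {V : Type u}

/-- The occurrence set of a finite word: the set of letters occurring in it. -/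
def occ (x : List V) : Set V := {v | v ∈ x}

/-- `score F w` is the maximal `k` such that some suffix of `w` decomposes as
`x₁ ⋯ x_k` with every `xᵢ` non-empty and `occ xᵢ = F` (with `max ∅ = 0`). -/
noncomputable def score (F : Set V) (w : List V) : ℕ :=
  sSup {k | ∃ xs : List (List V), xs.length = k ∧
    (∀ x ∈ xs, x ≠ [] ∧ occ x = F) ∧ xs.flatten <:+ w}

/-- `maxscore 𝓕 w` is the maximum of `score F u` over `F ∈ 𝓕` and non-empty
prefixes `u` of `w`. -/
noncomputable def maxscore (𝓕 : Set (Set V)) (w : List V) : ℕ :=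
  sSup {n | ∃ F ∈ 𝓕, ∃ u : List V, u ≠ [] ∧ u <+: w ∧ n = score F u}

/-- `AccGood F w x` : `x` is a suffix of `w` with `occ x ⊆ F` such that removing
any suffix `y` of `x` from `w` does not change the score of `F`. -/
def AccGood (F : Set V) (w x : List V) : Prop :=
  x <:+ w ∧ occ x ⊆ F ∧
    ∀ y : List V, y <:+ x → score F (w.take (w.length - y.length)) = score F w

/-- The accumulator `acc F w` : the occurrence set of the longest suffix `x` of `w`
with `occ x ⊆ F` such that the score of `F` did not change during `x`. -/
noncomputable def acc (F : Set V) (w : List V) : Set V :=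
  occ (w.drop (sInf {i | AccGood F w (w.drop i)}))

/-- A non-empty word `w` is an `𝓕`-burden if `maxscore 𝓕 w ≤ 2` and for every
`F ∈ 𝓕` either `score F w = 0`, or `score F w = 1` and `acc F w = ∅`. -/
def Burden (𝓕 : Set (Set V)) (w : List V) : Prop :=
  w ≠ [] ∧ maxscore 𝓕 w ≤ 2 ∧
    ∀ F ∈ 𝓕, score F w = 0 ∨ (score F w = 1 ∧ acc F w = ∅)

/-- The maxscore of an infinite sequence: the supremum (in `ℕ∞`) of the scores of
sets `F ∈ 𝓕` over all non-empty finite prefixes. -/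
noncomputable def maxscoreInf (𝓕 : Set (Set V)) (ρ : ℕ → V) : ℕ∞ :=
  ⨆ F ∈ 𝓕, ⨆ n : ℕ, (score F ((List.range (n + 1)).map ρ) : ℕ∞)

/-- The set of elements occurring infinitely often in the sequence `ρ`. -/
def limitSet (ρ : ℕ → V) : Set V := {v | ∀ N : ℕ, ∃ n, N ≤ n ∧ ρ n = v}

/-- The indicator of a play: the union of all `F ∈ 𝓕` with positive score
together with all non-empty accumulators of members of `𝓕`. -/
noncomputable def ind (𝓕 : Set (Set V)) (w : List V) : Set V :=
  (⋃ F ∈ {F ∈ 𝓕 | 0 < score F w}, F) ∪ ⋃ F ∈ {F ∈ 𝓕 | acc F w ≠ ∅}, acc F w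

/-- An arena: a finite directed graph together with the set `V0` of vertices of
Player 0 (Player 1 owns the complement), where every vertex has a successor. -/
structure Arena (V : Type u) where
  V0 : Set V
  E : V → V → Prop
  exists_succ : ∀ v, ∃ u, E v u

/-- The positions of Player `i`. -/
def Arena.pos (G : Arena V) (i : Fin 2) : Set V :=
  if i = 0 then G.V0 else G.V0ᶜ

/-- A strategy maps a history (the play so far, excluding the current vertex)
and the current vertex to a successor vertex. -/
abbrev Strategy (V : Type u) := List V → V → V

/-- A strategy is legal if it always moves along edges. -/
def Arena.Legal (G : Arena V) (σ : Strategy V) : Prop :=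
  ∀ w v, G.E v (σ w v)

/-- An infinite play in `G` starting in `v`. -/
def Arena.IsPlay (G : Arena V) (v : V) (ρ : ℕ → V) : Prop :=
  ρ 0 = v ∧ ∀ n, G.E (ρ n) (ρ (n + 1))

/-- An infinite play is consistent with the strategy `σ` of Player `i`. -/
def Arena.ConsistentInf (G : Arena V) (i : Fin 2) (σ : Strategy V) (ρ : ℕ → V) : Prop :=
  ∀ n, ρ n ∈ G.pos i → ρ (n + 1) = σ ((List.range n).map ρ) (ρ n)

/-- Player `i` (with winning condition `𝓕i`) wins the Muller game from `v`. -/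
def Arena.MullerWinFrom (G : Arena V) (i : Fin 2) (𝓕i : Set (Set V)) (v : V) : Prop :=
  ∃ σ : Strategy V, G.Legal σ ∧
    ∀ ρ : ℕ → V, G.IsPlay v ρ → G.ConsistentInf i σ ρ → limitSet ρ ∈ 𝓕i

/-- The winning region of Player `i` in the Muller game. -/
def Arena.MullerWinRegion (G : Arena V) (i : Fin 2) (𝓕i : Set (Set V)) : Set V :=
  {v | G.MullerWinFrom i 𝓕i v}

/-- A finite play is consistent with the strategy `σ` of Player `i`. -/
def Arena.ConsistentFin (G : Arena V) (i : Fin 2) (σ : Strategy V) (w : List V) : Prop :=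
  ∀ (u : List V) (v x : V), u ++ [v, x] <+: w → v ∈ G.pos i → x = σ u v

/-- A play of the finite-time Muller game with threshold `k`: a finite path
whose maxscore (over all subsets) is exactly `k`, while the maxscore of
its proper prefixes is `< k`. -/
def FTPlay (G : Arena V) (k : ℕ) (w : List V) : Prop :=
  w.Chain' G.E ∧ maxscore (Set.univ : Set (Set V)) w = k ∧
    maxscore (Set.univ : Set (Set V)) w.dropLast < k

/-- Player `i` wins the finite-time Muller game with threshold `k` from `v`. -/
def FTWinFrom (G : Arena V) (i : Fin 2) (𝓕i : Set (Set V)) (k : ℕ) (v : V) : Prop :=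
  ∃ σ : Strategy V, G.Legal σ ∧
    ∀ w : List V, FTPlay G k w → w.head? = some v → G.ConsistentFin i σ w →
      ∃ F ∈ 𝓕i, score F w = k

/-- The winning region of Player `i` in the finite-time Muller game. -/
def FTWinRegion (G : Arena V) (i : Fin 2) (𝓕i : Set (Set V)) (k : ℕ) : Set V :=
  {v | FTWinFrom G i 𝓕i k v}

/-- A play of McNaughton's finite-time Muller game: a finite path such that some
set `F` reaches score `|F|! + 1`, while no set did so in a proper prefix. -/
def McNPlay (G : Arena V) (w : List V) : Prop :=
  w.Chain' G.E ∧ (∃ F : Set V, score F w = F.ncard.factorial + 1) ∧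
    ∀ u : List V, u <+: w → u ≠ w →
      ∀ F : Set V, score F u ≠ F.ncard.factorial + 1

/-- Player `i` wins McNaughton's finite-time Muller game from `v`. -/
def McNWinFrom (G : Arena V) (i : Fin 2) (𝓕i : Set (Set V)) (v : V) : Prop :=
  ∃ σ : Strategy V, G.Legal σ ∧
    ∀ w : List V, McNPlay G w → w.head? = some v → G.ConsistentFin i σ w →
      ∃ F ∈ 𝓕i, score F w = F.ncard.factorial + 1

/-- The winning region of Player `i` in McNaughton's finite-time Muller game. -/
def McNWinRegion (G : Arena V) (i : Fin 2) (𝓕i : Set (Set V)) : Set V :=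
  {v | McNWinFrom G i 𝓕i v}

open Classical in
/-- The list `ρ₀ ⋯ ρₙ` of the first `n+1` vertices of the unique play that starts
in `v` and is consistent with the strategy `σ` of Player `i` and the strategy `τ`
of the other player. -/
noncomputable def playList (G : Arena V) (i : Fin 2) (σ τ : Strategy V) (v : V) :
    ℕ → List V
  | 0 => [v]
  | n + 1 =>
      let w := playList G i σ τ v n
      let u := w.getLastD v
      w ++ [if u ∈ G.pos i then σ w.dropLast u else τ w.dropLast u]

/-- `playOf G i σ τ v` : the unique play starting in `v` that is consistent with
the strategy `σ` of Player `i` and the strategy `τ` of the other player. -/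
noncomputable def playOf (G : Arena V) (i : Fin 2) (σ τ : Strategy V) (v : V)
    (n : ℕ) : V :=
  (playList G i σ τ v n).getLastD v

/-- `Walk R c s t A`: there is a non-empty `R`-walk from `s` to `t` along which exactly
the colours in `A` are seen, the colour of the first vertex not being counted. -/
inductive Walk {S : Type*} {C : Type*} (R : S → S → Prop) (c : S → C) : S → S → Set C → Prop
  | single {s t : S} : R s t → Walk R c s t {c t}
  | cons {s t r : S} {A : Set C} : R s t → Walk R c t r A → Walk R c s r (insert (c t) A)

namespace Walk

variable {S T C : Type*} {R R' : S → S → Prop} {c : S → C} {s t r : S} {A B : Set C}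

theorem append (h : Walk R c s t A) (h' : Walk R c t r B) : Walk R c s r (A ∪ B) := by
  induction h with
  | single h => rw [Set.singleton_union]; exact .cons h h'
  | cons h _ ih => rw [Set.insert_union]; exact .cons h (ih h')

theorem map {Q : T → T → Prop} {d : T → C} (f : S → T) (hd : ∀ s, d (f s) = c s)
    (hf : ∀ s t, R s t → Q (f s) (f t)) (h : Walk R c s t A) : Walk Q d (f s) (f t) A := by
  induction h with
  | single h => rw [← hd]; exact .single (hf _ _ h)
  | cons h _ ih => rw [← hd]; exact .cons (hf _ _ h) ih

theorem mono (hR : ∀ s t, R s t → R' s t) (h : Walk R c s t A) : Walk R' c s t A :=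
  h.map id (fun _ => rfl) hR

theorem reach (h : Walk R c s t A) : Relation.ReflTransGen R s t := by
  induction h with
  | single h => exact .single h
  | cons h _ ih => exact .head h ih

theorem color_mem (h : Walk R c s t A) : c t ∈ A := by
  induction h with
  | single h => rfl
  | cons h _ ih => exact Set.mem_insert_of_mem _ ih

theorem exists_of_color_mem (h : Walk R c s t A) {x : C} (hx : x ∈ A) :
    ∃ r, Relation.ReflTransGen R s r ∧ c r = x := by
  induction h with
  | single h => exact ⟨_, .single h, hx.symm⟩
  | cons h _ ih =>
    rcases hx with rfl | hx
    · exact ⟨_, .single h, rfl⟩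
    · obtain ⟨r, hr, e⟩ := ih hx
      exact ⟨r, .head h hr, e⟩

theorem exists_of_transGen (h : Relation.TransGen R s t) : ∃ A, Walk R c s t A := by
  induction h with
  | single h => exact ⟨_, .single h⟩
  | tail _ h ih =>
    obtain ⟨A, hA⟩ := ih
    exact ⟨_, hA.append (.single h)⟩

/-- A closed walk in a functional graph can be started at any vertex reachable from it. -/
theorem rotate_of_functional (hfun : ∀ s t r, R s t → R s r → t = r)
    (h : Walk R c s s A) (hst : Relation.ReflTransGen R s t) : Walk R c t t A := by
  induction hst with
  | refl => exact h
  | @tail x y _ hxy ih =>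
    cases ih with
    | single h' =>
      obtain rfl := hfun _ _ _ hxy h'
      exact .single h'
    | cons h' hw =>
      obtain rfl := hfun _ _ _ hxy h'
      rw [Set.insert_eq, Set.union_comm]
      exact hw.append (.single h')

end Walk

/-- In a finite type, every element is below a reflexive point of a transitive relation
that is serial. -/
theorem exists_refl_of_serial_trans {T : Type*} [Finite T] (Q : T → T → Prop)
    (htrans : ∀ a b d, Q a b → Q b d → Q a d) (hserial : ∀ a, ∃ b, Q a b) (a : T) :
    ∃ b, Q a b ∧ Q b b := by
  choose f hf using hserial
  have hlt : ∀ n k, Q (f^[n] a) (f^[n + k + 1] a) := by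
    intro n k
    induction k with
    | zero => rw [Nat.add_zero, Function.iterate_succ_apply']; exact hf _
    | succ k ih =>
      refine htrans _ _ _ ih ?_
      rw [← Nat.add_assoc, Function.iterate_succ_apply' f (n + k + 1)]
      exact hf _
  obtain ⟨m, n, hne, he⟩ := Finite.exists_ne_map_eq_of_infinite (fun n : ℕ => f^[n + 1] a)
  wlog hmn : m < n generalizing m n
  · exact this n m hne.symm he.symm (by omega)
  refine ⟨f^[m + 1] a, by simpa using hlt 0 m, ?_⟩
  have := hlt (m + 1) (n - m - 1)
  rw [show m + 1 + (n - m - 1) + 1 = n + 1 by omega] at this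
  simpa [← he] using this

section Positional

variable {S T C : Type*}

/-- `R` is a strategy of Player `i` in the graph `E`, with memory states `T` lying over the
vertices of `E` by `π`: it offers a move at each position of Player `i` and answers every move
of the other player. -/
structure IsStrategy (E : S → S → Prop) (own : S → Fin 2) (i : Fin 2) (π : T → S)
    (R : T → T → Prop) : Prop where
  sub : ∀ t t', R t t' → E (π t) (π t')
  own_move : ∀ t, own (π t) = i → ∃ t', R t t'
  opp_move : ∀ t s', own (π t) ≠ i → E (π t) s' → ∃ t', R t t' ∧ π t' = s'

/-- Every closed `R`-walk reachable from `t₀` has its colour set in `W`. -/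
def CycleWin (R : T → T → Prop) (c : T → C) (W : Set (Set C)) (t₀ : T) : Prop :=
  ∀ t A, Relation.ReflTransGen R t₀ t → Walk R c t t A → A ∈ W

/-- Player `i` wins from `s` with a positional strategy. -/
def PosWin (E : S → S → Prop) (own : S → Fin 2) (c : S → C) (W : Fin 2 → Set (Set C))
    (i : Fin 2) (s : S) : Prop :=
  ∃ R, IsStrategy E own i id R ∧ CycleWin R c (W i) s

/-- Player `i` wins from `s` with a finite-memory strategy. -/
def MemWin {S : Type u} (E : S → S → Prop) (own : S → Fin 2) (c : S → C)
    (W : Fin 2 → Set (Set C)) (i : Fin 2) (s : S) : Prop :=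
  ∃ (T : Type u) (_ : Finite T) (π : T → S) (R : T → T → Prop) (t₀ : T),
    π t₀ = s ∧ IsStrategy E own i π R ∧ CycleWin R (c ∘ π) (W i) t₀

/-- The colour sets of closed walks with a common base point are comparable. -/
def ChainCycles (E : S → S → Prop) (c : S → C) : Prop :=
  ∀ s A B, Walk E c s s A → Walk E c s s B → A ⊆ B ∨ B ⊆ A

theorem ChainCycles.union_mem {E : S → S → Prop} {c : S → C} (h : ChainCycles E c)
    {W : Set (Set C)} {s : S} {A B : Set C} (hA : Walk E c s s A) (hB : Walk E c s s B)
    (hAW : A ∈ W) (hBW : B ∈ W) : A ∪ B ∈ W := by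
  rcases h s A B hA hB with h | h
  · rwa [Set.union_eq_self_of_subset_left h]
  · rwa [Set.union_eq_self_of_subset_right h]

theorem ChainCycles.mono {E E' : S → S → Prop} {c : S → C} (h : ChainCycles E c)
    (hE : ∀ s t, E' s t → E s t) : ChainCycles E' c :=
  fun s A B hA hB => h s A B (hA.mono hE) (hB.mono hE)

theorem PosWin.memWin {S : Type u} [Finite S] {E : S → S → Prop} {own : S → Fin 2} {c : S → C}
    {W : Fin 2 → Set (Set C)} {i : Fin 2} {s : S} (h : PosWin E own c W i s) :
    MemWin E own c W i s := by
  obtain ⟨R, hR, hw⟩ := h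
  exact ⟨S, inferInstance, id, R, s, rfl, hR, hw⟩

theorem MemWin.not_both {S : Type u} {E : S → S → Prop} {own : S → Fin 2} {c : S → C}
    {W : Fin 2 → Set (Set C)} {i j : Fin 2} (hij : i ≠ j)
    (hW : Disjoint (W i) (W j)) {s : S}
    (h : MemWin E own c W i s) (h' : MemWin E own c W j s) : False := by
  obtain ⟨T, _, π, R, t₀, ht, hR, hw⟩ := h
  obtain ⟨T', _, π', R', t₀', ht', hR', hw'⟩ := h'
  let P := {p : T × T' // π p.1 = π' p.2}
  let Q : P → P → Prop := fun p q => R p.1.1 q.1.1 ∧ R' p.1.2 q.1.2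
  have hser : ∀ p, ∃ q, Relation.TransGen Q p q := by
    rintro ⟨⟨t, t'⟩, e⟩
    dsimp only at e
    by_cases ho : own (π t) = i
    · obtain ⟨r, hr⟩ := hR.own_move t ho
      obtain ⟨r', hr', e'⟩ := hR'.opp_move t' (π r) (by rw [← e, ho]; exact hij)
        (by rw [← e]; exact hR.sub _ _ hr)
      exact ⟨⟨(r, r'), e'.symm⟩, .single ⟨hr, hr'⟩⟩
    · obtain ⟨r', hr'⟩ := hR'.own_move t' (by rw [← e]; omega)
      obtain ⟨r, hr, e'⟩ := hR.opp_move t (π' r') ho (by rw [e]; exact hR'.sub _ _ hr')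
      exact ⟨⟨(r, r'), e'⟩, .single ⟨hr, hr'⟩⟩
  obtain ⟨p, hp, hpp⟩ := exists_refl_of_serial_trans (Relation.TransGen Q)
    (fun _ _ _ h h' => h.trans h') hser ⟨(t₀, t₀'), ht.trans ht'.symm⟩
  obtain ⟨A, hA⟩ := Walk.exists_of_transGen (c := fun p : P => c (π p.1.1)) hpp
  refine Set.disjoint_left.1 hW (hw p.1.1 A ?_ ?_) (hw' p.1.2 A ?_ ?_)
  · exact hp.to_reflTransGen.lift (fun p : P => p.1.1) fun _ _ h => h.1
  · exact hA.map (fun p : P => p.1.1) (fun _ => rfl) fun _ _ h => h.1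
  · exact hp.to_reflTransGen.lift (fun p : P => p.1.2) fun _ _ h => h.2
  · exact hA.map (fun p : P => p.1.2) (fun p => congrArg c p.2.symm) fun _ _ h => h.2

/-- If Player `i` never has a choice, then the whole graph is its only strategy. -/
theorem MemWin.posWin_of_no_choice {S : Type u} {E : S → S → Prop} {own : S → Fin 2} {c : S → C}
    {W : Fin 2 → Set (Set C)} {i : Fin 2} (hE : ∀ s, ∃ t, E s t)
    (hi : ∀ s t r, own s = i → E s t → E s r → t = r) {s : S}
    (h : MemWin E own c W i s) : PosWin E own c W i s := by
  obtain ⟨T, _, π, R, t₀, rfl, hR, hw⟩ := h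
  refine ⟨E, ⟨fun _ _ h => h, fun t _ => hE t, fun t s' _ h => ⟨s', h, rfl⟩⟩, ?_⟩
  have lift : ∀ t s', E (π t) s' → ∃ t', R t t' ∧ π t' = s' := by
    intro t s' h
    by_cases ho : own (π t) = i
    · obtain ⟨t', ht'⟩ := hR.own_move t ho
      exact ⟨t', ht', hi _ _ _ ho (hR.sub _ _ ht') h⟩
    · exact hR.opp_move t s' ho h
  have liftWalk : ∀ x y A, Walk E c x y A → ∀ t, π t = x →
      ∃ t', Walk R (c ∘ π) t t' A ∧ π t' = y := by
    intro x y A h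
    induction h with
    | single h =>
      rintro t rfl
      obtain ⟨t', h', rfl⟩ := lift _ _ h
      exact ⟨t', .single h', rfl⟩
    | cons h _ ih =>
      rintro t rfl
      obtain ⟨t', h', rfl⟩ := lift _ _ h
      obtain ⟨t'', h'', rfl⟩ := ih t' rfl
      exact ⟨t'', .cons h' h'', rfl⟩
  intro u A hu hA
  obtain ⟨t, ht, rfl⟩ : ∃ t, Relation.ReflTransGen R t₀ t ∧ π t = u := by
    clear hA
    induction hu with
    | refl => exact ⟨t₀, .refl, rfl⟩
    | tail _ h ih =>
      obtain ⟨t, ht, rfl⟩ := ih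
      obtain ⟨t', h', rfl⟩ := lift _ _ h
      exact ⟨t', ht.tail h', rfl⟩
  obtain ⟨⟨t', e⟩, h1, h2⟩ := exists_refl_of_serial_trans
    (fun x y : {x // π x = π t} => Walk R (c ∘ π) x.1 y.1 A)
    (fun x y z h h' => by simpa using h.append h')
    (fun x => by
      obtain ⟨y, hy, e⟩ := liftWalk _ _ _ hA x.1 x.2
      exact ⟨⟨y, e⟩, hy⟩) ⟨t, rfl⟩
  exact hw t' A (ht.trans h1.reach) h2

/-- A functional graph is won by one of the players. -/
theorem exists_posWin_of_functional {E : S → S → Prop} {own : S → Fin 2} {c : S → C}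
    {W : Fin 2 → Set (Set C)} (hW : ∀ A, ∃ i, A ∈ W i) (hE : ∀ s, ∃ t, E s t)
    (hfun : ∀ s t r, E s t → E s r → t = r) (s : S) : ∃ i, PosWin E own c W i s := by
  have hstrat : ∀ i, IsStrategy E own i id E := fun i =>
    ⟨fun _ _ h => h, fun t _ => hE t, fun t s' _ h => ⟨s', h, rfl⟩⟩
  by_cases hex : ∃ t A, Relation.ReflTransGen E s t ∧ Walk E c t t A
  · obtain ⟨t, A, hst, hA⟩ := hex
    obtain ⟨i, hi⟩ := hW A
    refine ⟨i, E, hstrat i, fun u B hu hB => ?_⟩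
    suffices A = B by rwa [← this]
    have sub : ∀ u A B, Walk E c u u A → Walk E c u u B → A ⊆ B := by
      intro u A B hA hB x hx
      obtain ⟨r, hr, rfl⟩ := hA.exists_of_color_mem hx
      exact (hB.rotate_of_functional hfun hr).color_mem
    rcases Relation.ReflTransGen.total_of_right_unique (r := E) (fun _ _ _ h h' => hfun _ _ _ h h') hst hu
      with h | h
    · have := hA.rotate_of_functional hfun h
      exact (sub _ _ _ this hB).antisymm (sub _ _ _ hB this)
    · have := hB.rotate_of_functional hfun h
      exact (sub _ _ _ hA this).antisymm (sub _ _ _ this hA)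
  · obtain ⟨i, -⟩ := hW ∅
    exact ⟨i, E, hstrat i, fun t A ht hA => (hex ⟨t, A, ht, hA⟩).elim⟩

/-- If Player `j` wins positionally both after deleting some moves of the other player at `v`
and after deleting the remaining ones, then Player `j` wins: follow at all times the strategy
for the part containing the last move taken at `v`. -/
theorem memWin_of_split {S : Type u} [Finite S] {E : S → S → Prop} {own : S → Fin 2} {c : S → C}
    {W : Fin 2 → Set (Set C)} {j : Fin 2} (hchain : ChainCycles E c) {v : S} (hv : own v ≠ j)
    (D : Bool → S → S → Prop) (hD : ∀ b x y, D b x y → E x y)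
    (hDv : ∀ y, E v y → ∃ b, D b v y) (hDne : ∀ b x y, x ≠ v → E x y → D b x y)
    {s : S} (h : ∀ b, PosWin (D b) own c W j s) : MemWin E own c W j s := by
  choose R hR hw using h
  by_cases hreach : ∃ b, ¬ Relation.ReflTransGen (R b) s v
  · obtain ⟨b, hb⟩ := hreach
    have hsub : ∀ x y, Relation.ReflTransGen (R b) s x → R b x y ∨ (x = v ∧ E v y) → R b x y := by
      rintro x y hx (h | ⟨rfl, -⟩)
      exacts [h, (hb hx).elim]
    refine PosWin.memWin ⟨fun x y => R b x y ∨ (x = v ∧ E v y), ⟨?_, ?_, ?_⟩, ?_⟩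
    · rintro x y (h | ⟨rfl, h⟩)
      exacts [hD b _ _ ((hR b).sub _ _ h), h]
    · intro x hx
      obtain ⟨y, hy⟩ := (hR b).own_move x hx
      exact ⟨y, .inl hy⟩
    · intro x y hx hxy
      by_cases e : x = v
      · subst e
        exact ⟨y, .inr ⟨rfl, hxy⟩, rfl⟩
      · obtain ⟨z, hz, rfl⟩ := (hR b).opp_move x y hx (hDne b x y e hxy)
        exact ⟨z, .inl hz, rfl⟩
    · intro t A ht hA
      have ht' : Relation.ReflTransGen (R b) s t := by
        clear hA
        induction ht with
        | refl => exact .refl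
        | tail _ h ih => exact ih.tail (hsub _ _ ih h)
      refine hw b t A ht' ?_
      have key : ∀ x y A, Walk (fun x y => R b x y ∨ (x = v ∧ E v y)) c x y A →
          Relation.ReflTransGen (R b) s x → Walk (R b) c x y A := by
        intro x y A h
        induction h with
        | single h => exact fun hx => .single (hsub _ _ hx h)
        | cons h _ ih =>
          exact fun hx => .cons (hsub _ _ hx h) (ih (hx.tail (hsub _ _ hx h)))
      exact key _ _ _ hA ht'
  · push Not at hreach
    let Q : S × Bool → S × Bool → Prop := fun p q => R q.2 p.1 q.1 ∧ (p.1 ≠ v → q.2 = p.2)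
    have hRE : ∀ b x y, R b x y → E x y := fun b x y h => hD b _ _ ((hR b).sub _ _ h)
    refine ⟨S × Bool, inferInstance, Prod.fst, Q, (s, true), rfl, ⟨?_, ?_, ?_⟩, ?_⟩
    · exact fun p q h => hRE _ _ _ h.1
    · rintro ⟨x, b⟩ hx
      obtain ⟨y, hy⟩ := (hR b).own_move x hx
      exact ⟨(y, b), hy, fun _ => rfl⟩
    · rintro ⟨x, b⟩ y hx hxy
      by_cases e : x = v
      · subst e
        obtain ⟨b', hb'⟩ := hDv y hxy
        obtain ⟨z, hz, rfl⟩ := (hR b').opp_move _ y hx hb'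
        exact ⟨(z, b'), ⟨hz, fun h => (h rfl).elim⟩, rfl⟩
      · obtain ⟨z, hz, rfl⟩ := (hR b).opp_move x y hx (hDne b x y e hxy)
        exact ⟨(z, b), ⟨hz, fun _ => rfl⟩, rfl⟩
    · have inv : ∀ p, Relation.ReflTransGen Q (s, true) p →
          Relation.ReflTransGen (R p.2) s p.1 := by
        intro p hp
        induction hp with
        | refl => exact .refl
        | @tail p q _ h ih =>
          by_cases e : p.1 = v
          · exact (hreach q.2).tail (e ▸ h.1)
          · have hq := h.1
            rw [h.2 e] at hq ⊢
            exact ih.tail hq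
      have toV : ∀ p q A, Walk Q (c ∘ Prod.fst) p q A → q.1 = v →
          ∃ b A₁, Walk (R b) c p.1 v A₁ ∧ (p.1 ≠ v → b = p.2) ∧
            (A = A₁ ∨ ∃ A₂, A = A₁ ∪ A₂ ∧ A₂ ∈ W j ∧ Walk E c v v A₂) := by
        intro p q A h hq
        induction h with
        | @single p q h => exact ⟨q.2, _, hq ▸ .single h.1, h.2, .inl rfl⟩
        | @cons p r q A h _ ih =>
          obtain ⟨b, A₁, h1, hb, hA⟩ := ih hq
          by_cases e : r.1 = v
          · rw [e] at h1
            have hcl := h1.mono (hRE b)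
            refine ⟨r.2, {c r.1}, by simpa [e] using Walk.single (c := c) h.1, h.2, .inr ⟨A, ?_⟩⟩
            have h1W := hw b v A₁ (hreach b) h1
            rcases hA with rfl | ⟨A₂, rfl, h2W, h2⟩
            · exact ⟨by simp [e], h1W, hcl⟩
            · exact ⟨by simp [e], hchain.union_mem hcl h2 h1W h2W,
                by simpa using hcl.append h2⟩
          · obtain rfl := hb e
            refine ⟨r.2, _, .cons h.1 h1, h.2, ?_⟩
            rcases hA with rfl | ⟨A₂, rfl, h2⟩
            · exact .inl rfl
            · exact .inr ⟨A₂, (Set.insert_union).symm, h2⟩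
      have atV : ∀ p A, p.1 = v → Walk Q (c ∘ Prod.fst) p p A → A ∈ W j := by
        intro p A hp h
        obtain ⟨b, A₁, h1, -, hA⟩ := toV p p A h hp
        rw [hp] at h1
        have h1W := hw b v A₁ (hreach b) h1
        rcases hA with rfl | ⟨A₂, rfl, h2W, h2⟩
        · exact h1W
        · exact hchain.union_mem (h1.mono (hRE b)) h2 h1W h2W
      have split : ∀ p q A, Walk Q (c ∘ Prod.fst) p q A → p.1 = v ∨
          (q.2 = p.2 ∧ Walk (R p.2) c p.1 q.1 A) ∨ ∃ r A₁ A₂, r.1 = v ∧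
            Walk Q (c ∘ Prod.fst) p r A₁ ∧ Walk Q (c ∘ Prod.fst) r q A₂ ∧ A = A₁ ∪ A₂ := by
        intro p q A h
        induction h with
        | @single p q h =>
          by_cases e : p.1 = v
          · exact .inl e
          · exact .inr (.inl ⟨h.2 e, .single (h.2 e ▸ h.1)⟩)
        | @cons p r q A h hrest ih =>
          by_cases e : p.1 = v
          · exact .inl e
          refine .inr ?_
          rcases ih with hr | ⟨hb, hr⟩ | ⟨x, A₁, A₂, hx, h1, h2, rfl⟩
          · exact .inr ⟨r, _, _, hr, .single h, hrest, Set.insert_eq _ _⟩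
          · have hq := h.1
            rw [h.2 e] at hb hr hq
            exact .inl ⟨hb, .cons hq hr⟩
          · exact .inr ⟨x, _, A₂, hx, .cons h h1, h2, (Set.insert_union).symm⟩
      intro p A hp hA
      rcases split p p A hA with e | ⟨-, h⟩ | ⟨r, A₁, A₂, hr, h1, h2, rfl⟩
      · exact atV p A e hA
      · exact hw p.2 p.1 A (inv p hp) h
      · rw [Set.union_comm]
        exact atV r _ hr (h2.append h1)

/-- A Muller condition whose closed walks with common base point have comparable colour sets
is positionally determined. -/
theorem exists_posWin {S : Type u} [Finite S] {own : S → Fin 2} {c : S → C}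
    {W : Fin 2 → Set (Set C)} (hW : ∀ A, ∃ i, A ∈ W i) (hdis : Disjoint (W 0) (W 1))
    (E : S → S → Prop) (hE : ∀ s, ∃ t, E s t) (hchain : ChainCycles E c) (s : S) :
    ∃ i, PosWin E own c W i s := by
  induction E using WellFoundedLT.induction with
  | ind E ih =>
  have step : ∀ i j, i ≠ j → (∃ v a b, own v = i ∧ E v a ∧ E v b ∧ a ≠ b) →
      PosWin E own c W i s ∨ MemWin E own c W j s := by
    rintro i j hij ⟨v, a, b, hv, ha, hb, hab⟩
    let D : Bool → S → S → Prop := fun d x y => E x y ∧ (x = v → (y = a ↔ d = true))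
    have hDE : ∀ d x y, D d x y → E x y := fun _ _ _ h => h.1
    have hlt : ∀ d, D d < E := by
      intro d
      refine lt_of_le_of_ne (hDE d) fun e => ?_
      have h1 : D d v a := e ▸ ha
      have h2 : D d v b := e ▸ hb
      exact hab ((h2.2 rfl).2 ((h1.2 rfl).1 rfl)).symm
    have hser : ∀ d x, ∃ y, D d x y := by
      intro d x
      by_cases e : x = v
      · subst e
        cases d
        · exact ⟨b, hb, fun _ => by simpa using hab.symm⟩
        · exact ⟨a, ha, fun _ => by simp⟩
      · obtain ⟨y, hy⟩ := hE x
        exact ⟨y, hy, fun h => (e h).elim⟩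
    have hpos := fun d => ih (D d) (hlt d) (hser d) (hchain.mono (hDE d))
    by_cases hi : ∃ d, PosWin (D d) own c W i s
    · obtain ⟨d, R, hR, hw⟩ := hi
      refine .inl ⟨R, ⟨fun x y h => hDE d _ _ (hR.sub x y h), hR.own_move, ?_⟩, hw⟩
      exact fun x y hx hxy => hR.opp_move x y hx ⟨hxy, fun e => (hx (e ▸ hv)).elim⟩
    · refine .inr (memWin_of_split hchain (v := v) (by rw [hv]; exact hij) D hDE ?_ ?_ ?_)
      · intro y hy
        by_cases e : y = a
        · exact ⟨true, hy, by simp [e]⟩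
        · exact ⟨false, hy, by simp [e]⟩
      · exact fun d x y hx hxy => ⟨hxy, fun e => (hx e).elim⟩
      · intro d
        obtain ⟨k, hk⟩ := hpos d
        have : k ≠ i := by
          rintro rfl
          exact hi ⟨d, hk⟩
        rwa [show j = k by omega]
  have nochoice : ∀ i, (¬ ∃ v a b, own v = i ∧ E v a ∧ E v b ∧ a ≠ b) →
      ∀ x y z, own x = i → E x y → E x z → y = z := by
    intro i hi x y z hx hy hz
    by_contra e
    exact hi ⟨x, y, z, hx, hy, hz, e⟩
  by_cases h0 : ∃ v a b, own v = 0 ∧ E v a ∧ E v b ∧ a ≠ b <;>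
  by_cases h1 : ∃ v a b, own v = 1 ∧ E v a ∧ E v b ∧ a ≠ b
  · rcases step 0 1 (by decide) h0 with h | h
    · exact ⟨0, h⟩
    rcases step 1 0 (by decide) h1 with h' | h'
    · exact ⟨1, h'⟩
    exact (MemWin.not_both (by decide) hdis h' h).elim
  · rcases step 0 1 (by decide) h0 with h | h
    · exact ⟨0, h⟩
    · exact ⟨1, h.posWin_of_no_choice hE (nochoice 1 h1)⟩
  · rcases step 1 0 (by decide) h1 with h | h
    · exact ⟨1, h⟩
    · exact ⟨0, h.posWin_of_no_choice hE (nochoice 0 h0)⟩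
  · refine exists_posWin_of_functional hW hE (fun x y z hy hz => ?_) s
    have : own x = 0 ∨ own x = 1 := by omega
    rcases this with h | h
    · exact nochoice 0 h0 x y z h hy hz
    · exact nochoice 1 h1 x y z h hy hz

end Positional

section Score

theorem bddAbove_score (F : Set V) (w : List V) :
    BddAbove {k | ∃ xs : List (List V), xs.length = k ∧
      (∀ x ∈ xs, x ≠ [] ∧ occ x = F) ∧ xs.flatten <:+ w} := by
  refine ⟨w.length, ?_⟩
  rintro _ ⟨xs, rfl, hxs, hsuf⟩
  refine le_trans ?_ hsuf.length_le
  clear hsuf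
  induction xs with
  | nil => simp
  | cons x xs ih =>
    have h1 := ih fun y hy => hxs y (List.mem_cons_of_mem _ hy)
    have h2 := List.length_pos_iff.2 (hxs x List.mem_cons_self).1
    simp only [List.length_cons, List.flatten_cons, List.length_append]
    omega

theorem exists_score_eq (F : Set V) (w : List V) :
    ∃ xs : List (List V), xs.length = score F w ∧
      (∀ x ∈ xs, x ≠ [] ∧ occ x = F) ∧ xs.flatten <:+ w :=
  Nat.sSup_mem (s := {k | ∃ xs : List (List V), xs.length = k ∧
    (∀ x ∈ xs, x ≠ [] ∧ occ x = F) ∧ xs.flatten <:+ w})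
    ⟨0, [], rfl, by simp, by simp⟩ (bddAbove_score F w)

theorem le_score {F : Set V} {w : List V} {xs : List (List V)}
    (hxs : ∀ x ∈ xs, x ≠ [] ∧ occ x = F) (h : xs.flatten <:+ w) : xs.length ≤ score F w :=
  le_csSup (bddAbove_score F w) ⟨xs, rfl, hxs, h⟩

theorem score_nil (F : Set V) : score F [] = 0 := by
  obtain ⟨xs, h, hxs, hsuf⟩ := exists_score_eq F []
  rw [← h, List.length_eq_zero_iff]
  by_contra hne
  obtain ⟨x, hx⟩ := List.exists_mem_of_ne_nil _ hne
  exact (hxs x hx).1 (List.flatten_eq_nil_iff.1 (List.suffix_nil.1 hsuf) x hx)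

theorem score_append_singleton_le (F : Set V) (w : List V) (a : V) :
    score F (w ++ [a]) ≤ score F w + 1 := by
  obtain ⟨xs, h, hxs, hsuf⟩ := exists_score_eq F (w ++ [a])
  rw [← h]
  rcases List.eq_nil_or_concat' xs with rfl | ⟨ys, x, rfl⟩
  · simp
  rcases List.eq_nil_or_concat' ys with rfl | ⟨zs, y, rfl⟩
  · simp
  obtain ⟨x', b, rfl⟩ := (List.eq_nil_or_concat' x).resolve_left (hxs x (by simp)).1
  have hx := (hxs (x' ++ [b]) (by simp)).2
  have hy := hxs y (by simp)
  have hle := le_score (F := F) (w := w) (xs := zs ++ [y ++ x']) (fun z hz => by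
    rcases List.mem_append.1 hz with hz | hz
    · exact hxs z (by simp [hz])
    · obtain rfl := List.mem_singleton.1 hz
      refine ⟨by simp [hy.1], ?_⟩
      ext c
      simp only [occ, Set.ext_iff, Set.mem_ofPred_eq, List.mem_append] at hx hy ⊢
      constructor
      · rintro (hc | hc)
        exacts [(hy.2 c).1 hc, (hx c).1 (.inl hc)]
      · exact fun hc => .inl ((hy.2 c).2 hc)) (by
    obtain ⟨l, hl⟩ := hsuf
    refine ⟨l, ?_⟩
    have : (l ++ (zs ++ [y ++ x']).flatten) ++ [b] = w ++ [a] := by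
      rw [← hl]
      simp
    exact (List.append_inj' this rfl).1)
  simpa using hle

theorem exists_forall_mem_limitSet [Finite V] (ρ : ℕ → V) :
    ∃ N, ∀ n, N ≤ n → ρ n ∈ limitSet ρ := by
  have h : ∀ a, ∃ N, a ∉ limitSet ρ → ∀ n, N ≤ n → ρ n ≠ a := by
    intro a
    by_cases ha : a ∈ limitSet ρ
    · exact ⟨0, fun h => (h ha).elim⟩
    · simp only [limitSet, Set.mem_ofPred_eq, not_forall, not_exists, not_and] at ha
      obtain ⟨N, hN⟩ := ha
      exact ⟨N, fun _ => hN⟩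
  choose f hf using h
  obtain ⟨B, hB⟩ := (Set.finite_range f).bddAbove
  refine ⟨B, fun n hn => ?_⟩
  by_contra h
  exact hf _ h n (le_trans (hB ⟨_, rfl⟩) hn) rfl

theorem exists_bound_limitSet [Finite V] (ρ : ℕ → V) (n : ℕ) :
    ∃ M, ∀ a ∈ limitSet ρ, ∃ k, n ≤ k ∧ k ≤ M ∧ ρ k = a := by
  have h : ∀ a, ∃ k, a ∈ limitSet ρ → n ≤ k ∧ ρ k = a := by
    intro a
    by_cases ha : a ∈ limitSet ρ
    · obtain ⟨k, hk⟩ := ha n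
      exact ⟨k, fun _ => hk⟩
    · exact ⟨0, fun h => (ha h).elim⟩
  choose f hf using h
  obtain ⟨B, hB⟩ := (Set.finite_range f).bddAbove
  exact ⟨B, fun a ha => ⟨f a, (hf a ha).1, hB ⟨_, rfl⟩, (hf a ha).2⟩⟩

/-- Along an infinite sequence, every score is attained by the limit set. -/
theorem exists_score_limitSet_eq [Finite V] (ρ : ℕ → V) (k : ℕ) :
    ∃ n, score (limitSet ρ) ((List.range n).map ρ) = k := by
  obtain ⟨N, hN⟩ := exists_forall_mem_limitSet ρ
  have hblocks : ∀ k, ∃ n, N ≤ n ∧ ∃ xs : List (List V), xs.length = k ∧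
      (∀ x ∈ xs, x ≠ [] ∧ occ x = limitSet ρ) ∧
      (List.range n).map ρ = (List.range N).map ρ ++ xs.flatten := by
    intro k
    induction k with
    | zero => exact ⟨N, le_rfl, [], by simp⟩
    | succ k ih =>
      obtain ⟨n, hn, xs, hlen, hxs, he⟩ := ih
      obtain ⟨M, hM⟩ := exists_bound_limitSet ρ n
      obtain ⟨l, -, hl, -⟩ := hM _ (hN N le_rfl)
      refine ⟨n + (M + 1 - n), by omega,
        xs ++ [(List.range (M + 1 - n)).map fun j => ρ (n + j)], by simp [hlen], ?_, ?_⟩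
      · intro x hx
        rcases List.mem_append.1 hx with hx | hx
        · exact hxs x hx
        obtain rfl := List.mem_singleton.1 hx
        have hocc : occ ((List.range (M + 1 - n)).map fun j => ρ (n + j)) = limitSet ρ := by
          ext a
          simp only [occ, Set.mem_ofPred_eq, List.mem_map, List.mem_range]
          constructor
          · rintro ⟨j, -, rfl⟩
            exact hN _ (by omega)
          · intro ha
            obtain ⟨j, h1, h2, rfl⟩ := hM a ha
            exact ⟨j - n, by omega, by congr 1; omega⟩
        refine ⟨fun h => ?_, hocc⟩
        have := hN N le_rfl
        rw [← hocc, h] at this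
        simp [occ] at this
      · rw [List.range_add, List.map_append, he]
        simp [Function.comp_def]
  have hge : ∃ n, k ≤ score (limitSet ρ) ((List.range n).map ρ) := by
    obtain ⟨n, -, xs, rfl, hxs, he⟩ := hblocks k
    exact ⟨n, le_score hxs ⟨_, he.symm⟩⟩
  classical
  refine ⟨Nat.find hge, le_antisymm ?_ (Nat.find_spec hge)⟩
  rcases h : Nat.find hge with _ | n
  · simp [score_nil]
  · have h1 := Nat.find_min hge (m := n) (by omega)
    have h2 := score_append_singleton_le (limitSet ρ) ((List.range n).map ρ) (ρ n)
    rw [List.range_succ, List.map_append]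
    exact h2.trans (by omega)

end Score

section LatestAppearanceRecord

theorem Arena.notMem_pos_iff (G : Arena V) {i j : Fin 2} (hij : i ≠ j) (x : V) :
    x ∉ G.pos i ↔ x ∈ G.pos j := by
  fin_cases i <;> fin_cases j <;> simp_all [Arena.pos]

theorem occ_append_singleton (l : List V) (a : V) : occ (l ++ [a]) = occ l ∪ {a} := by
  ext
  simp [occ, or_comm]

variable [DecidableEq V]

theorem List.dedup_dedup_append (l x : List V) : (l.dedup ++ x).dedup = (l ++ x).dedup := by
  induction l with
  | nil => simp
  | cons a l ih =>
    by_cases h : a ∈ l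
    · rw [List.dedup_cons_of_mem h, ih, List.cons_append,
        List.dedup_cons_of_mem (List.mem_append_left _ h)]
    · rw [List.dedup_cons_of_notMem h, List.dedup_append, List.cons_union, ← List.dedup_append, ih,
        List.dedup_append (a :: l), List.cons_union, ← List.dedup_append]

theorem List.dedup_suffix_dedup_append (l x : List V) : x.dedup <:+ (l ++ x).dedup := by
  rw [List.dedup_append]
  exact List.suffix_union_right _ _

/-- The current vertex together with the list of all visited vertices, ordered by their last
visit. -/
abbrev Lar (V : Type u) := V × {l : List V // l.Nodup}

/-- The record after the play `w` followed by the current vertex `x`. -/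
def larState (w : List V) (x : V) : Lar V := (x, ⟨(w ++ [x]).dedup, List.nodup_dedup _⟩)

/-- The update of records along the edges of `G`. -/
def Arena.larEdge (G : Arena V) (p q : Lar V) : Prop :=
  G.E p.1 q.1 ∧ q.2.1 = (p.2.1 ++ [q.1]).dedup

theorem Arena.larEdge_larState {G : Arena V} {w : List V} {x y : V} (h : G.E x y) :
    G.larEdge (larState w x) (larState (w ++ [x]) y) :=
  ⟨h, (List.dedup_dedup_append _ _).symm⟩

theorem Arena.larEdge.eq_larState {G : Arena V} {w : List V} {x : V} {q : Lar V}
    (h : G.larEdge (larState w x) q) : q = larState (w ++ [x]) q.1 :=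
  Prod.ext rfl (Subtype.ext (h.2.trans (List.dedup_dedup_append _ _)))

theorem Arena.larEdge_serial (G : Arena V) (p : Lar V) : ∃ q, G.larEdge p q := by
  obtain ⟨y, hy⟩ := G.exists_succ p.1
  exact ⟨(y, ⟨(p.2.1 ++ [y]).dedup, List.nodup_dedup _⟩), hy, rfl⟩

theorem Arena.exists_word_of_walk {G : Arena V} {p q : Lar V} {A : Set V}
    (h : Walk G.larEdge Prod.fst p q A) : ∃ x : List V, occ x = A ∧
      q.2.1 = (p.2.1 ++ x).dedup := by
  induction h with
  | @single p q h => exact ⟨[q.1], by simp [occ], h.2⟩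
  | @cons p r q A h _ ih =>
    obtain ⟨x, rfl, hx⟩ := ih
    refine ⟨r.1 :: x, by ext; simp [occ], ?_⟩
    rw [hx, h.2, List.dedup_dedup_append, List.append_assoc, List.singleton_append]

theorem Arena.chainCycles_larEdge (G : Arena V) : ChainCycles G.larEdge Prod.fst := by
  have key : ∀ p A, Walk G.larEdge Prod.fst p p A →
      ∃ x : List V, x <:+ p.2.1 ∧ ∀ a, a ∈ A ↔ a ∈ x := by
    intro p A h
    obtain ⟨x, rfl, hx⟩ := G.exists_word_of_walk h
    refine ⟨x.dedup, ?_, fun a => List.mem_dedup.symm⟩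
    rw [hx]
    exact List.dedup_suffix_dedup_append _ _
  intro p A B hA hB
  obtain ⟨x, hx, hxA⟩ := key p A hA
  obtain ⟨y, hy, hyB⟩ := key p B hB
  rcases List.suffix_or_suffix_of_suffix hx hy with h | h
  · exact .inl fun a ha => (hyB a).2 (h.subset ((hxA a).1 ha))
  · exact .inr fun a ha => (hxA a).2 (h.subset ((hyB a).1 ha))

/-- `σ` is a strategy of Player `i` all of whose plays follow `R` on the records. -/
def Arena.Follows (G : Arena V) (i : Fin 2) (σ : Strategy V) (R : Lar V → Lar V → Prop) : Prop :=
  ∀ w x y, G.E x y → (x ∈ G.pos i → y = σ w x) → R (larState w x) (larState (w ++ [x]) y)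

theorem Arena.exists_larStrategy [Finite V] (G : Arena V) {W : Fin 2 → Set (Set V)}
    (hW : ∀ A, ∃ i, A ∈ W i) (hdis : Disjoint (W 0) (W 1)) (v : V) :
    ∃ i σ R, G.Legal σ ∧ G.Follows i σ R ∧ CycleWin R Prod.fst (W i) (larState [] v) := by
  classical
  have : Fintype V := Fintype.ofFinite V
  let own : Lar V → Fin 2 := fun p => if p.1 ∈ G.pos 0 then 0 else 1
  have hown : ∀ p i, own p = i ↔ p.1 ∈ G.pos i := by
    intro p i
    by_cases h : p.1 ∈ G.pos 0
    · have h1 : p.1 ∉ G.pos 1 := (G.notMem_pos_iff (by decide) _).2 h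
      fin_cases i <;> simp [own, h, h1]
    · have h1 : p.1 ∈ G.pos 1 := (G.notMem_pos_iff (by decide) _).1 h
      fin_cases i <;> simp [own, h, h1]
  obtain ⟨i, R, hR, hw⟩ := exists_posWin (own := own) hW hdis G.larEdge G.larEdge_serial
    G.chainCycles_larEdge (larState [] v)
  have hex : ∀ w x, ∃ y, G.E x y ∧
      (x ∈ G.pos i → R (larState w x) (larState (w ++ [x]) y)) := by
    intro w x
    by_cases hx : x ∈ G.pos i
    · obtain ⟨q, hq⟩ := hR.own_move (larState w x) ((hown _ _).2 hx)
      have hE := hR.sub _ _ hq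
      refine ⟨q.1, hE.1, fun _ => ?_⟩
      exact hE.eq_larState (q := q) ▸ hq
    · obtain ⟨y, hy⟩ := G.exists_succ x
      exact ⟨y, hy, fun h => (hx h).elim⟩
  choose σ hσ hσR using hex
  refine ⟨i, σ, R, hσ, fun w x y hxy hy => ?_, hw⟩
  by_cases hx : x ∈ G.pos i
  · rw [hy hx]
    exact hσR w x hx
  · obtain ⟨q, hq, e⟩ := hR.opp_move (larState w x) _ (fun h => hx ((hown _ _).1 h))
      (G.larEdge_larState hxy)
    rwa [← e]

theorem mullerWinFrom_of_follows [Finite V] {G : Arena V} {i : Fin 2} {σ : Strategy V}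
    {R : Lar V → Lar V → Prop} {W : Set (Set V)} {v : V} (hσ : G.Legal σ)
    (hf : G.Follows i σ R) (hw : CycleWin R Prod.fst W (larState [] v)) :
    G.MullerWinFrom i W v := by
  have : Fintype V := Fintype.ofFinite V
  refine ⟨σ, hσ, fun ρ ⟨h0, hE⟩ hcons => ?_⟩
  let s : ℕ → Lar V := fun n => larState ((List.range n).map ρ) (ρ n)
  have hs : ∀ n, R (s n) (s (n + 1)) := by
    intro n
    have := hf _ _ _ (hE n) (hcons n)
    simpa [s, List.range_succ] using this
  have hwalk : ∀ n k, Walk R Prod.fst (s n) (s (n + k + 1))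
      {a | ∃ m, n < m ∧ m ≤ n + k + 1 ∧ ρ m = a} := by
    intro n k
    induction k with
    | zero =>
      convert Walk.single (c := Prod.fst) (hs n) using 1
      ext a
      constructor
      · rintro ⟨m, h1, h2, rfl⟩
        obtain rfl : m = n + 1 := by omega
        rfl
      · rintro rfl
        exact ⟨n + 1, by omega, by omega, rfl⟩
    | succ k ih =>
      suffices h : {a | ∃ m, n < m ∧ m ≤ n + (k + 1) + 1 ∧ ρ m = a} =
          {a | ∃ m, n < m ∧ m ≤ n + k + 1 ∧ ρ m = a} ∪ {(s (n + k + 1 + 1)).1} by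
        rw [h]
        exact ih.append (.single (hs (n + k + 1)))
      ext a
      constructor
      · rintro ⟨m, h1, h2, rfl⟩
        rcases Nat.lt_or_ge (n + k + 1) m with h | h
        · obtain rfl : m = n + k + 1 + 1 := by omega
          exact .inr rfl
        · exact .inl ⟨m, h1, h, rfl⟩
      · rintro (⟨m, h1, h2, rfl⟩ | rfl)
        · exact ⟨m, h1, by omega, rfl⟩
        · exact ⟨n + k + 1 + 1, by omega, by omega, rfl⟩
  have hreach : ∀ n, Relation.ReflTransGen R (larState [] v) (s n) := by
    intro n
    induction n with
    | zero => simp only [s, h0]; exact .refl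
    | succ n ih => exact ih.tail (hs n)
  obtain ⟨N, hN⟩ := exists_forall_mem_limitSet ρ
  obtain ⟨p, hp⟩ : ∃ p, ∀ N, ∃ n, N ≤ n ∧ s n = p := by
    by_contra! h
    choose f hf using h
    obtain ⟨B, hB⟩ := (Set.finite_range f).bddAbove
    exact hf (s B) B (hB ⟨_, rfl⟩) rfl
  obtain ⟨n, hn, hnp⟩ := hp N
  obtain ⟨M, hM⟩ := exists_bound_limitSet ρ (n + 1)
  obtain ⟨m, hm, hmp⟩ := hp (max M (n + 1))
  have hwk := hwalk n (m - n - 1)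
  rw [show n + (m - n - 1) + 1 = m by omega, hmp, hnp] at hwk
  have := hw p _ (hnp ▸ hreach n) hwk
  convert this using 1
  ext a
  constructor
  · intro ha
    obtain ⟨k, h1, h2, h3⟩ := hM a ha
    exact ⟨k, h1, by omega, h3⟩
  · rintro ⟨k, h1, h2, rfl⟩
    exact hN k (by omega)

/-- There are only `|F|!` possible orders of the last visits to the members of `F`, so after more
than `|F|!` blocks the same order has occurred twice. -/
theorem exists_lt_dedup_eq [Finite V] {F : Set V} {xs : List (List V)}
    (hlen : F.ncard.factorial < xs.length) (hxs : ∀ x ∈ xs, x ≠ [] ∧ occ x = F) :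
    ∃ U M Z : List V, xs.flatten = U ++ M ++ Z ∧ U ≠ [] ∧ M ≠ [] ∧ occ M = F ∧
      U.dedup = (U ++ M).dedup := by
  have hocc : ∀ ys : List (List V), ys ≠ [] → (∀ y ∈ ys, y ∈ xs) →
      ys.flatten ≠ [] ∧ occ ys.flatten = F := by
    intro ys hne hys
    obtain ⟨y, hy⟩ := List.exists_mem_of_ne_nil _ hne
    constructor
    · intro h
      exact (hxs y (hys y hy)).1 (List.flatten_eq_nil_iff.1 h y hy)
    · ext a
      simp only [occ, Set.mem_ofPred_eq, List.mem_flatten]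
      constructor
      · rintro ⟨z, hz, ha⟩
        rw [← (hxs z (hys z hz)).2]
        exact ha
      · intro ha
        rw [← (hxs y (hys y hy)).2] at ha
        exact ⟨y, hy, ha⟩
  have hF := F.toFinite
  let P : Finset (List V) := hF.toFinset.toList.permutations.toFinset
  have hP : P.card < (Finset.range xs.length).card := by
    refine lt_of_le_of_lt (List.toFinset_card_le _) ?_
    rwa [List.length_permutations, Finset.length_toList, ← Set.ncard_eq_toFinset_card F hF,
      Finset.card_range]
  have hmaps : ∀ j ∈ Finset.range xs.length, (xs.take (j + 1)).flatten.dedup ∈ P := by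
    intro j hj
    rw [Finset.mem_range] at hj
    have h := (hocc (xs.take (j + 1)) (by
      rw [← List.length_pos_iff, List.length_take]; omega) fun y => List.mem_of_mem_take).2
    rw [List.mem_toFinset, List.mem_permutations,
      List.perm_ext_iff_of_nodup (List.nodup_dedup _) (Finset.nodup_toList _)]
    intro a
    rw [List.mem_dedup, Finset.mem_toList, hF.mem_toFinset, ← h]
    rfl
  obtain ⟨j, hj, k, hk, hne, he⟩ := Finset.exists_ne_map_eq_of_card_lt_of_maps_to hP hmaps
  wlog hjk : j < k generalizing j k
  · exact this k hk j hj hne.symm he.symm (by omega)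
  rw [Finset.mem_range] at hj hk
  have hsplit : xs.take (k + 1) = xs.take (j + 1) ++ (xs.drop (j + 1)).take (k - j) := by
    rw [← List.take_add]
    congr 1
    omega
  have hU := hocc (xs.take (j + 1)) (by
    rw [← List.length_pos_iff, List.length_take]; omega) fun y => List.mem_of_mem_take
  have hM := hocc ((xs.drop (j + 1)).take (k - j)) (by
    rw [← List.length_pos_iff, List.length_take, List.length_drop]; omega)
    fun y hy => List.mem_of_mem_drop (List.mem_of_mem_take hy)
  refine ⟨_, _, (xs.drop (k + 1)).flatten, ?_, hU.1, hM.1, hM.2, ?_⟩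
  · rw [← List.flatten_append, ← List.flatten_append, ← hsplit, List.take_append_drop]
  · rw [← List.flatten_append, ← hsplit]
    exact he

theorem walk_of_follows {G : Arena V} {i : Fin 2} {σ : Strategy V}
    {R : Lar V → Lar V → Prop} (hf : G.Follows i σ R) {w : List V} (hch : w.IsChain G.E)
    (hcons : G.ConsistentFin i σ w) (a b : List V) (x y : V)
    (h : a ++ [x] ++ (b ++ [y]) <+: w) :
    Walk R Prod.fst (larState a x) (larState (a ++ [x] ++ b) y) (occ (b ++ [y])) := by
  have hstep : ∀ u x y, u ++ [x, y] <+: w → R (larState u x) (larState (u ++ [x]) y) := by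
    intro u x y h
    refine hf u x y ?_ (hcons u x y h)
    have := hch.prefix h
    simpa using (List.isChain_append.1 this).2.1
  induction b using List.reverseRecOn generalizing y with
  | nil =>
    have hy : occ ([] ++ [y]) = {y} := by ext; simp [occ]
    rw [hy, List.append_nil]
    exact .single (hstep a x y (by simpa using h))
  | append_singleton b z ih =>
    have h1 := ih z (by
      refine List.IsPrefix.trans ⟨[y], ?_⟩ h
      simp)
    have h2 := hstep (a ++ [x] ++ b) z y (by simpa using h)
    rw [occ_append_singleton, ← List.append_assoc]
    exact h1.append (.single h2)

theorem mem_of_follows_of_score [Finite V] {G : Arena V} {i : Fin 2} {σ : Strategy V}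
    {R : Lar V → Lar V → Prop} {W : Set (Set V)} {v : V} (hf : G.Follows i σ R)
    (hw : CycleWin R Prod.fst W (larState [] v)) {w : List V} (hch : w.IsChain G.E)
    (hhead : w.head? = some v) (hcons : G.ConsistentFin i σ w) {F : Set V}
    (hF : F.ncard.factorial < score F w) : F ∈ W := by
  obtain ⟨xs, hlen, hxs, a, ha⟩ := exists_score_eq F w
  obtain ⟨U, M, Z, hUMZ, hU, hM, rfl, hd⟩ := exists_lt_dedup_eq (hlen ▸ hF) hxs
  obtain ⟨u, x, rfl⟩ := (List.eq_nil_or_concat' U).resolve_left hU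
  obtain ⟨m, y, rfl⟩ := (List.eq_nil_or_concat' M).resolve_left hM
  rw [hUMZ] at ha
  have hlast : x = y := by
    obtain ⟨l, hl⟩ := List.dedup_suffix_dedup_append u [x]
    obtain ⟨l', hl'⟩ := List.dedup_suffix_dedup_append (u ++ [x] ++ m) [y]
    rw [← List.append_assoc, ← hl', ← hl] at hd
    simpa using (List.append_inj' hd rfl).2
  subst hlast
  have hstate : larState (a ++ u ++ [x] ++ m) x = larState (a ++ u) x := by
    refine Prod.ext rfl (Subtype.ext ?_)
    change (a ++ u ++ [x] ++ m ++ [x]).dedup = (a ++ u ++ [x]).dedup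
    rw [List.append_assoc a u, List.dedup_append a, hd, ← List.dedup_append]
    simp
  have hwk := walk_of_follows hf hch hcons (a ++ u) m x x ⟨Z, by rw [← ha]; simp⟩
  rw [hstate] at hwk
  refine hw _ _ ?_ hwk
  cases hau : a ++ u with
  | nil =>
    have : w = x :: (m ++ [x] ++ Z) := by
      rw [← ha]
      simp [List.append_eq_nil_iff.1 hau]
    rw [this] at hhead
    obtain rfl : x = v := by simpa using hhead
    exact .refl
  | cons z b =>
    have e : w = [] ++ [z] ++ (b ++ [x]) ++ (m ++ [x] ++ Z) := by
      rw [← ha]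
      simpa using congrArg (· ++ (x :: (m ++ x :: Z))) hau
    obtain rfl : z = v := by simpa [e] using hhead
    exact (walk_of_follows hf hch hcons [] b z x ⟨_, e.symm⟩).reach

end LatestAppearanceRecord

theorem exists_play {G : Arena V} {i j : Fin 2} (hij : i ≠ j) {σ τ : Strategy V}
    (hσ : G.Legal σ) (hτ : G.Legal τ) (v : V) :
    ∃ ρ, G.IsPlay v ρ ∧ G.ConsistentInf i σ ρ ∧ G.ConsistentInf j τ ρ := by
  classical
  let next : List V × V → V := fun p => if p.2 ∈ G.pos i then σ p.1 p.2 else τ p.1 p.2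
  let s : ℕ → List V × V := fun n => n.rec ([], v) fun _ p => (p.1 ++ [p.2], next p)
  have hs : ∀ n, (s n).1 = (List.range n).map fun k => (s k).2 := by
    intro n
    induction n with
    | zero => rfl
    | succ n ih =>
      rw [List.range_succ, List.map_append, ← ih]
      rfl
  refine ⟨fun n => (s n).2, ⟨rfl, fun n => ?_⟩, fun n hn => ?_, fun n hn => ?_⟩
  · change G.E (s n).2 (next (s n))
    by_cases h : (s n).2 ∈ G.pos i
    · simpa [next, h] using hσ _ _
    · simpa [next, h] using hτ _ _
  · change next (s n) = _
    rw [← hs]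
    exact if_pos hn
  · change next (s n) = _
    rw [← hs]
    exact if_neg ((G.notMem_pos_iff hij _).2 hn)

theorem Arena.MullerWinFrom.not_both {G : Arena V} {i j : Fin 2} (hij : i ≠ j)
    {A B : Set (Set V)} (hdis : Disjoint A B) {v : V} (h : G.MullerWinFrom i A v)
    (h' : G.MullerWinFrom j B v) : False := by
  obtain ⟨σ, hσ, hw⟩ := h
  obtain ⟨τ, hτ, hw'⟩ := h'
  obtain ⟨ρ, hρ, h1, h2⟩ := exists_play hij hσ hτ v
  exact Set.disjoint_left.1 hdis (hw ρ hρ h1) (hw' ρ hρ h2)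

/-- Player `i` has a strategy from `v` that prevents every set outside of `A` from reaching its
threshold. -/
def BoundedWinFrom (G : Arena V) (i : Fin 2) (A : Set (Set V)) (v : V) : Prop :=
  ∃ σ : Strategy V, G.Legal σ ∧ ∀ w : List V, w.IsChain G.E → w.head? = some v →
    G.ConsistentFin i σ w → ∀ F : Set V, score F w = F.ncard.factorial + 1 → F ∈ A

theorem BoundedWinFrom.mcNWinFrom {G : Arena V} {i : Fin 2} {A : Set (Set V)} {v : V}
    (h : BoundedWinFrom G i A v) : McNWinFrom G i A v := by
  obtain ⟨σ, hσ, hw⟩ := h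
  refine ⟨σ, hσ, fun w ⟨hch, ⟨F, hF⟩, _⟩ hhead hcons => ⟨F, ?_, hF⟩⟩
  exact hw w hch hhead hcons F hF

theorem isChain_map_range {E : V → V → Prop} {ρ : ℕ → V} (h : ∀ n, E (ρ n) (ρ (n + 1)))
    (n : ℕ) : ((List.range n).map ρ).IsChain E := by
  rw [List.isChain_iff_getElem]
  intro k hk
  simpa using h k

theorem Arena.ConsistentInf.consistentFin {G : Arena V} {i : Fin 2} {σ : Strategy V}
    {ρ : ℕ → V} (h : G.ConsistentInf i σ ρ) (n : ℕ) :
    G.ConsistentFin i σ ((List.range n).map ρ) := by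
  rintro u x y ⟨z, hz⟩ hx
  have hlen := congrArg List.length hz
  simp only [List.length_append, List.length_cons, List.length_nil, List.length_map,
    List.length_range] at hlen
  have hget : ∀ k, ((List.range n).map ρ)[k]? = if k < n then some (ρ k) else none := by
    intro k
    by_cases hk : k < n <;> simp [hk]
  have hu : u = (List.range u.length).map ρ := by
    have := congrArg (List.take u.length) hz
    rw [List.append_assoc, List.take_left, ← List.map_take, List.take_range] at this
    rwa [min_eq_left (by omega)] at this
  have h1 : ρ u.length = x := by
    have := hget u.length
    rw [← hz, if_pos (by omega)] at this
    simpa using this.symm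
  have h2 : ρ (u.length + 1) = y := by
    have := hget (u.length + 1)
    rw [← hz, if_pos (by omega)] at this
    simpa using this.symm
  have := h u.length (h1 ▸ hx)
  rwa [h1, h2, ← hu] at this

theorem exists_mcNPlay_prefix [Finite V] {G : Arena V} {v : V} {ρ : ℕ → V}
    (hρ : G.IsPlay v ρ) : ∃ n, McNPlay G ((List.range n).map ρ) ∧
      ((List.range n).map ρ).head? = some v := by
  classical
  have hex : ∃ n, ∃ F : Set V, score F ((List.range n).map ρ) = F.ncard.factorial + 1 := by
    obtain ⟨n, hn⟩ := exists_score_limitSet_eq ρ ((limitSet ρ).ncard.factorial + 1)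
    exact ⟨n, _, hn⟩
  refine ⟨Nat.find hex, ⟨isChain_map_range hρ.2 _, Nat.find_spec hex, ?_⟩, ?_⟩
  · intro u hu hne F hF
    have hle := hu.length_le
    rw [List.prefix_iff_eq_take, ← List.map_take, List.take_range] at hu
    rw [List.length_map, List.length_range] at hle
    rw [min_eq_left hle] at hu
    refine Nat.find_min hex (lt_of_le_of_ne hle fun e => hne ?_) ⟨F, hu ▸ hF⟩
    rwa [e] at hu
  · obtain ⟨F, hF⟩ := Nat.find_spec hex
    rcases h : Nat.find hex with _ | n
    · rw [h] at hF
      simp [score_nil] at hF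
    · simp [List.range_succ_eq_map, hρ.1]

theorem BoundedWinFrom.not_mcNWinFrom [Finite V] {G : Arena V} {i j : Fin 2} (hij : i ≠ j)
    {A B : Set (Set V)} (hdis : Disjoint A B) {v : V} (h : BoundedWinFrom G i A v)
    (h' : McNWinFrom G j B v) : False := by
  obtain ⟨σ, hσ, hw⟩ := h
  obtain ⟨τ, hτ, hw'⟩ := h'
  obtain ⟨ρ, hρ, h1, h2⟩ := exists_play hij hσ hτ v
  obtain ⟨n, hn, hv⟩ := exists_mcNPlay_prefix hρ
  obtain ⟨F, hFB, hF⟩ := hw' _ hn hv (h2.consistentFin n)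
  exact Set.disjoint_left.1 hdis (hw _ hn.1 hv (h1.consistentFin n) F hF) hFB

theorem exists_mullerWinFrom_and_boundedWinFrom [Finite V] (G : Arena V)
    {W : Fin 2 → Set (Set V)} (hW : ∀ A, ∃ i, A ∈ W i) (hdis : Disjoint (W 0) (W 1)) (v : V) :
    ∃ i, G.MullerWinFrom i (W i) v ∧ BoundedWinFrom G i (W i) v := by
  classical
  obtain ⟨i, σ, R, hσ, hf, hw⟩ := G.exists_larStrategy hW hdis v
  exact ⟨i, mullerWinFrom_of_follows hσ hf hw, σ, hσ, fun w hch hhead hcons F hF =>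
    mem_of_follows_of_score hf hw hch hhead hcons (by omega)⟩

theorem mullerWinFrom_iff_mcNWinFrom [Finite V] (G : Arena V) {W : Fin 2 → Set (Set V)}
    (hW : ∀ A, ∃ i, A ∈ W i) (hdis : Disjoint (W 0) (W 1)) (i : Fin 2) (v : V) :
    G.MullerWinFrom i (W i) v ↔ McNWinFrom G i (W i) v := by
  obtain ⟨j, hj, hj'⟩ := exists_mullerWinFrom_and_boundedWinFrom G hW hdis v
  by_cases hij : j = i
  · subst hij
    exact iff_of_true hj hj'.mcNWinFrom
  · have hd : Disjoint (W j) (W i) := by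
      fin_cases i <;> fin_cases j <;> first | exact (hij rfl).elim | exact hdis | exact hdis.symm
    exact iff_of_false (fun h => hj.not_both hij hd h) fun h => hj'.not_mcNWinFrom hij hd h

/-- The winning regions of the Muller game `(G, 𝓕₀, 𝓕₁)`
coincide with the winning regions of McNaughton's finite-time Muller game, in
which a play is stopped and won by Player `j` as soon as some set `F ∈ 𝓕_j`
reaches score `|F|! + 1`. -/
theorem stmt_10 {V : Type u} [Fintype V] (G : Arena V)
    (F0 F1 : Set (Set V)) (hpart : F0 ∪ F1 = Set.univ) (hdisj : Disjoint F0 F1) :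
    G.MullerWinRegion 0 F0 = McNWinRegion G 0 F0 ∧
      G.MullerWinRegion 1 F1 = McNWinRegion G 1 F1 := by
  let W : Fin 2 → Set (Set V) := ![F0, F1]
  have hW : ∀ A, ∃ i, A ∈ W i := by
    intro A
    rcases hpart.symm ▸ Set.mem_univ A with h | h
    exacts [⟨0, h⟩, ⟨1, h⟩]
  exact ⟨Set.ext fun v => mullerWinFrom_iff_mcNWinFrom G hW hdisj 0 v,
    Set.ext fun v => mullerWinFrom_iff_mcNWinFrom G hW hdisj 1 v⟩
end

section
/- For each i ∈ {0,1}, Player i has a winning strategy σ for her winning region W_i in a Muller game 𝒢 = (G, 𝓕₀, 𝓕₁) such that maxscore_{𝓕_{1−i}}(play(v, σ, τ)) ≤ 2 for every vertex v ∈ W_i and every strategy τ of Player 1−i. -/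
/- Common definitions for finite-time Muller games, following
   McNaughton / Fearnley-Zimmermann. -/

universe u

variable {V : Type u}

/-- The word `h` (most recent letter first) starts with three consecutive words, each
with occurrence set the non-empty set `F`. -/
def Triple (F : Set V) (h : List V) : Prop :=
  F.Nonempty ∧ ∃ x y z r : List V, occ x = F ∧ occ y = F ∧ occ z = F ∧
    h = x ++ y ++ (z ++ r)

/-- No `F ∈ 𝓕` inside `X` has been completed strictly before the most recent letter of the
history `w` (most recent letter first) without being left since. -/
def Unburdened (𝓕 : Set (Set V)) (X : Set V) (w : List V) : Prop :=
  ∀ F ∈ 𝓕, F ⊆ X → F.Nonempty → ∀ y x r : List V, y ≠ [] → occ y ⊆ F → occ x = F →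
    w ≠ y ++ (x ++ r)

/-- A set of histories (most recent letter first) within which the player owning `P` can keep
the play on the subarena `X`, and in which no `F ∈ 𝓕` inside `X` reaches score three. -/
def SafeSet (E : V → V → Prop) (P : Set V) (𝓕 : Set (Set V)) (X : Set V)
    (S : Set (List V)) : Prop :=
  ∀ h ∈ S, (∀ F ∈ 𝓕, F ⊆ X → ¬ Triple F h) ∧ ∃ v r, h = v :: r ∧ v ∈ X ∧
    (v ∈ P → ∃ u ∈ X, E v u ∧ u :: h ∈ S) ∧ (v ∉ P → ∀ u ∈ X, E v u → u :: h ∈ S)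

/-- The player owning `P` can keep the scores of all `F ∈ 𝓕` at most two on `X`, after any
unburdened history. -/
def Good (E : V → V → Prop) (P : Set V) (𝓕 : Set (Set V)) (X : Set V) : Prop :=
  ∃ S, SafeSet E P 𝓕 X S ∧ ∀ w, Unburdened 𝓕 X w → ∀ v ∈ X, v :: w ∈ S

/-- In the subarena `X`, the player owning `P` can stay in `A` and her opponent cannot
leave it. -/
def ClosedFor (E : V → V → Prop) (P X A : Set V) : Prop :=
  ∀ v ∈ A, (v ∈ P → ∃ u ∈ A, E v u) ∧ (v ∉ P → ∀ u ∈ X, E v u → u ∈ A)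

/-- From `U \ T` the player owning `P` can force the rank to decrease inside `U`. -/
def Ranked (E : V → V → Prop) (P X T U : Set V) (rk : V → ℕ) : Prop :=
  ∀ v ∈ U, v ∉ T → (v ∈ P → ∃ u ∈ U, E v u ∧ rk u < rk v) ∧
    (v ∉ P → ∀ u ∈ X, E v u → u ∈ U ∧ rk u < rk v)

/-- The subarena `X` splits into regions on which the respective player can bound the scores
of the sets that are winning for the opponent. -/
def Determined (E : V → V → Prop) (P : Set V) (𝓐 𝓑 : Set (Set V)) (X : Set V) : Prop :=
  ∃ A B, A ∪ B = X ∧ Disjoint A B ∧ ClosedFor E P X A ∧ ClosedFor E Pᶜ X B ∧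
    Good E P 𝓑 A ∧ Good E Pᶜ 𝓐 B

lemma mem_occ {v : V} {x : List V} : v ∈ occ x ↔ v ∈ x := Iff.rfl

lemma Determined.symm {E : V → V → Prop} {P : Set V} {𝓐 𝓑 : Set (Set V)} {X : Set V}
    (h : Determined E Pᶜ 𝓑 𝓐 X) : Determined E P 𝓐 𝓑 X := by
  obtain ⟨A, B, hu, hd, hA, hB, gA, gB⟩ := h
  rw [compl_compl] at hB gB
  exact ⟨B, A, by rw [Set.union_comm, hu], hd.symm, hB, hA, gB, gA⟩

lemma Unburdened.not_triple {𝓕 : Set (Set V)} {X : Set V} {w : List V}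
    (hw : Unburdened 𝓕 X w) {F : Set V} (hF : F ∈ 𝓕) (hFX : F ⊆ X) : ¬ Triple F w := by
  rintro ⟨hne, x, y, z, r, hx, hy, -, rfl⟩
  refine hw F hF hFX hne x y (z ++ r) ?_ hx.subset hy (by simp)
  rintro rfl
  obtain ⟨f, hf⟩ := hne
  rw [← hx] at hf
  simp [occ] at hf

lemma Unburdened.exists_double {𝓕 : Set (Set V)} {X : Set V} {w : List V}
    (hw : Unburdened 𝓕 X w) {F : Set V} (hF : F ∈ 𝓕) (hFX : F ⊆ X) {l : List V}
    (h : Triple F (l ++ w)) :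
    F.Nonempty ∧ ∃ x y z, l = x ++ (y ++ z) ∧ occ x = F ∧ occ y = F := by
  obtain ⟨hne, x, y, z, r, hx, hy, hz, he⟩ := h
  refine ⟨hne, ?_⟩
  rcases List.append_eq_append_iff.1 he with ⟨t, ht, hw'⟩ | ⟨t, ht, -⟩
  · rcases eq_or_ne t [] with rfl | htne
    · exact ⟨x, y, [], by simpa using ht.symm, hx, hy⟩
    · refine absurd hw' (hw F hF hFX hne t z r htne ?_ hz)
      intro f hf
      have : f ∈ x ++ y := by rw [ht]; exact List.mem_append_right _ hf
      rcases List.mem_append.1 this with h | h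
      · rw [← hx]; exact h
      · rw [← hy]; exact h
  · exact ⟨x, y, t, by simpa using ht, hx, hy⟩

lemma unburdened_nil (𝓕 : Set (Set V)) (X : Set V) : Unburdened 𝓕 X [] := by
  intro F _ _ _ y x r hy _ _ h
  simp at h
  exact hy h.1

lemma Unburdened.mono {𝓕 : Set (Set V)} {X Y : Set V} {w : List V}
    (hw : Unburdened 𝓕 X w) (h : Y ⊆ X) : Unburdened 𝓕 Y w :=
  fun F hF hFY => hw F hF (hFY.trans h)

lemma unburdened_of_not_mem {𝓕 : Set (Set V)} {X : Set V} {v : V} {w : List V}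
    (h : v ∉ X) : Unburdened 𝓕 X (v :: w) := by
  rintro F - hFX - (_ | ⟨a, y⟩) x r hy hyF - he
  · exact hy rfl
  · simp only [List.cons_append, List.cons.injEq] at he
    exact h (hFX (hyF (by simp [occ, he.1])))

/-- A history that leaves a set `C` covering every active word is unburdened. -/
lemma unburdened_of_exit {𝓕 : Set (Set V)} {X C : Set V} {w l : List V} {u : V}
    (hC : ∀ F ∈ 𝓕, F ⊆ X → ∀ s, s <+: w → occ s ⊆ F → occ s ⊆ C)
    (hl : occ l ⊆ C) (hu : u ∉ C) : Unburdened 𝓕 X (u :: (l ++ w)) := by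
  rintro F hF hFX - (_ | ⟨a, y⟩) x r hy hyF hx he
  · exact hy rfl
  simp only [List.cons_append, List.cons.injEq] at he
  obtain ⟨rfl, he⟩ := he
  have hux : u ∈ x := by
    rw [← mem_occ, hx]; exact hyF (by simp [occ])
  rw [← List.append_assoc] at he
  rcases List.append_eq_append_iff.1 he with ⟨t, ht, hw'⟩ | ⟨t, ht, -⟩
  · have htF : occ t ⊆ F := by
      intro f hf
      have : f ∈ y ++ x := by rw [ht]; exact List.mem_append_right _ hf
      rcases List.mem_append.1 this with h | h
      · exact hyF (List.mem_cons_of_mem _ h)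
      · rw [← hx]; exact h
    have htC := hC F hF hFX t ⟨r, hw'.symm⟩ htF
    have : u ∈ l ++ t := by rw [← ht]; exact List.mem_append_right _ hux
    rcases List.mem_append.1 this with h | h
    · exact hu (hl h)
    · exact hu (htC h)
  · exact hu (hl (by rw [mem_occ, ht]; simp [hux]))

/-- Some proper subset of `X` covers every active word of the history `w`. -/
lemma exists_cover {𝓕 : Set (Set V)} {X : Set V} (hX : X ∉ 𝓕) (hne : X.Nonempty)
    (w : List V) :
    ∃ C ⊂ X, ∀ F ∈ 𝓕, F ⊆ X → ∀ s, s <+: w → occ s ⊆ F → occ s ⊆ C := by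
  by_cases h : ∃ F ∈ 𝓕, F ⊆ X
  · let Q : ℕ → Prop := fun n => ∃ F ∈ 𝓕, F ⊆ X ∧ ∃ s, s <+: w ∧ occ s ⊆ F ∧ s.length = n
    have hQ0 : Q 0 := by
      obtain ⟨F, hF, hFX⟩ := h
      exact ⟨F, hF, hFX, [], List.nil_prefix, by simp [occ], rfl⟩
    classical
    have hs := Nat.findGreatest_spec (P := Q) (Nat.zero_le w.length) hQ0
    obtain ⟨C, hC, hCX, s, hsw, hsC, hlen⟩ := hs
    refine ⟨C, hCX.ssubset_of_ne (fun he => hX (he ▸ hC)), ?_⟩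
    intro F hF hFX t ht htF
    have : t.length ≤ s.length := by
      rw [hlen]
      exact Nat.le_findGreatest ht.length_le ⟨F, hF, hFX, t, ht, htF, rfl⟩
    have hts := List.prefix_of_prefix_length_le ht hsw this
    exact fun f hf => hsC (hts.subset hf)
  · push Not at h
    exact ⟨∅, Set.empty_ssubset.2 hne, fun F hF hFX => absurd hFX (h F hF)⟩

lemma exists_attractor [Finite V] (E : V → V → Prop) (P X T : Set V) (hT : T ⊆ X) :
    ∃ (U : Set V) (rk : V → ℕ), T ⊆ U ∧ U ⊆ X ∧ Ranked E P X T U rk ∧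
      (∀ v ∈ X, v ∉ U → (v ∈ P → ∀ u ∈ X, E v u → u ∉ U) ∧
        (v ∉ P → ∃ u ∈ X, u ∉ U ∧ E v u)) := by
  classical
  let 𝓢 : Set (Set V) := {U | T ⊆ U ∧ U ⊆ X ∧ ∃ rk, Ranked E P X T U rk}
  have h𝓢 : 𝓢.Nonempty := ⟨T, subset_rfl, hT, fun _ => 0, fun v hv hv' => absurd hv hv'⟩
  obtain ⟨U, hU⟩ := (Set.toFinite 𝓢).exists_maximal h𝓢
  obtain ⟨hTU, hUX, rk, hrk⟩ := hU.prop
  refine ⟨U, rk, hTU, hUX, hrk, fun v hvX hvU => ?_⟩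
  obtain ⟨M, hM⟩ : ∃ M, ∀ u, rk u < M := by
    obtain ⟨M, hM⟩ := (Set.finite_range rk).bddAbove
    exact ⟨M + 1, fun u => Nat.lt_succ_of_le (hM ⟨u, rfl⟩)⟩
  by_contra hcon
  have hstep : (v ∈ P → ∃ u ∈ U, E v u) ∧ (v ∉ P → ∀ u ∈ X, E v u → u ∈ U) := by
    by_contra hc
    apply hcon
    grind
  apply hvU
  refine hU.le_of_ge (y := insert v U) ⟨hTU.trans (Set.subset_insert _ _),
    Set.insert_subset hvX hUX, Function.update rk v M, ?_⟩ (Set.subset_insert _ _)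
    (Set.mem_insert _ _)
  have hup : ∀ u ∈ U, Function.update rk v M u = rk u := fun u hu =>
    Function.update_of_ne (by rintro rfl; exact hvU hu) _ _
  rintro a (rfl | ha) haT
  · refine ⟨fun haP => ?_, fun haP u hu he => ?_⟩
    · obtain ⟨u, hu, he⟩ := hstep.1 haP
      exact ⟨u, Set.mem_insert_of_mem _ hu, he, by simp [hup u hu, hM]⟩
    · have := hstep.2 haP u hu he
      exact ⟨Set.mem_insert_of_mem _ this, by simp [hup u this, hM]⟩
  · refine ⟨fun haP => ?_, fun haP u hu he => ?_⟩
    · obtain ⟨u, hu, he, hlt⟩ := (hrk a ha haT).1 haP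
      exact ⟨u, Set.mem_insert_of_mem _ hu, he, by rwa [hup u hu, hup a ha]⟩
    · obtain ⟨hu', hlt⟩ := (hrk a ha haT).2 haP u hu he
      exact ⟨Set.mem_insert_of_mem _ hu', by rwa [hup u hu', hup a ha]⟩

/-- A word without repetition in its first part `a :: m`, disjoint from the rest `l`, prevents
scores of three. -/
lemma Unburdened.not_triple_of_path {𝓕 : Set (Set V)} {X : Set V} {w m l : List V} {a : V}
    {rk : V → ℕ} (hw : Unburdened 𝓕 X w) (hm : ∀ b ∈ m, rk a < rk b) (hl : a ∉ l)
    {F : Set V} (hF : F ∈ 𝓕) (hFX : F ⊆ X) : ¬ Triple F (a :: (m ++ (l ++ w))) := by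
  intro h
  have h' : Triple F ((a :: (m ++ l)) ++ w) := by simpa using h
  obtain ⟨⟨f, hf⟩, x, y, z, he, hx, hy⟩ := hw.exists_double hF hFX h'
  rcases x with _ | ⟨b, x⟩
  · rw [← hx] at hf; simp [occ] at hf
  · simp only [List.cons_append, List.cons.injEq] at he
    obtain ⟨rfl, he⟩ := he
    have hay : a ∈ y := by rw [← mem_occ, hy, ← hx]; simp [occ]
    have : a ∈ m ++ l := by rw [he]; simp [hay]
    rcases List.mem_append.1 this with h | h
    · exact lt_irrefl _ (hm a h)
    · exact hl h

/-- While the play stays in `Y`, sets that are not inside `Y` do not reach score three. -/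
lemma Unburdened.not_triple_of_subset {𝓕 : Set (Set V)} {X Y : Set V} {w y m : List V} {v : V}
    (hw : Unburdened 𝓕 X w) (hv : v ∈ Y) (hy : occ y ⊆ Y) (hm : ∀ b ∈ m, b ∉ Y)
    {F : Set V} (hF : F ∈ 𝓕) (hFX : F ⊆ X) (hFY : ¬ F ⊆ Y) :
    ¬ Triple F (v :: (y ++ (m ++ w))) := by
  intro h
  have h' : Triple F ((v :: (y ++ m)) ++ w) := by simpa using h
  obtain ⟨⟨f, hf⟩, x, z, t, he, hx, hz⟩ := hw.exists_double hF hFX h'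
  obtain ⟨g, hgF, hgY⟩ := Set.not_subset.1 hFY
  rcases x with _ | ⟨b, x⟩
  · rw [← hx] at hf; simp [occ] at hf
  · simp only [List.cons_append, List.cons.injEq] at he
    obtain ⟨rfl, he⟩ := he
    have hvz : v ∈ z := by rw [← mem_occ, hz, ← hx]; simp [occ]
    have hgx : g ∈ x := by
      have : g ∈ v :: x := by rw [← mem_occ, hx]; exact hgF
      rcases List.mem_cons.1 this with rfl | h
      · exact absurd hv hgY
      · exact h
    rcases List.append_eq_append_iff.1 he with ⟨c, hc, hm'⟩ | ⟨c, hc, -⟩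
    · exact hm v (by rw [hm']; simp [hvz]) hv
    · exact hgY (hy (by rw [mem_occ, hc]; simp [hgx]))

/-- The player owning `P` can combine bounded play on `B`, an attractor `U` of `T`, and
bounded play on `T`. -/
lemma Good.union_attractor {E : V → V → Prop} {P : Set V} {𝓕 : Set (Set V)} {B T U : Set V}
    {rk : V → ℕ} (hB : Good E P 𝓕 B) (hT : Good E P 𝓕 T) (hTU : T ⊆ U) (hBU : Disjoint B U)
    (hcl : ClosedFor E P (B ∪ U) T) (hrk : Ranked E P (B ∪ U) T U rk) :
    Good E P 𝓕 (B ∪ U) := by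
  obtain ⟨SB, hSB, hiB⟩ := hB
  obtain ⟨ST, hST, hiT⟩ := hT
  have hBU' : ∀ v ∈ B, v ∉ U := fun v hv hv' => Set.disjoint_left.1 hBU hv hv'
  let S1 : Set (List V) := {h | ∃ v y w, h = v :: (y ++ w) ∧ v ∈ B ∧ occ y ⊆ B ∧
    Unburdened 𝓕 (B ∪ U) w ∧ h ∈ SB}
  let S2 : Set (List V) := {h | ∃ a m l w, h = a :: (m ++ (l ++ w)) ∧ a ∈ U ∧ a ∉ T ∧
    (∀ b ∈ m, b ∈ U ∧ b ∉ T) ∧ (∀ b ∈ m, rk a < rk b) ∧ occ l ⊆ B ∧ Unburdened 𝓕 (B ∪ U) w}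
  let S3 : Set (List V) := {h | ∃ v y m w, h = v :: (y ++ (m ++ w)) ∧ v ∈ T ∧ occ y ⊆ T ∧
    (∀ b ∈ m, b ∉ T) ∧ Unburdened 𝓕 (B ∪ U) w ∧ h ∈ ST}
  have enterT : ∀ v ∈ T, ∀ m w, (∀ b ∈ m, b ∉ T) → Unburdened 𝓕 (B ∪ U) w →
      v :: (m ++ w) ∈ S3 := by
    intro v hv m w hm hw
    refine ⟨v, [], m, w, rfl, hv, by simp [occ], hm, hw, hiT _ ?_ v hv⟩
    rcases m with _ | ⟨b, m⟩
    · exact hw.mono (hTU.trans Set.subset_union_right)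
    · exact unburdened_of_not_mem (hm b (by simp))
  have enterU : ∀ v ∈ U, ∀ l w, occ l ⊆ B → Unburdened 𝓕 (B ∪ U) w →
      v :: (l ++ w) ∈ S1 ∪ S2 ∪ S3 := by
    intro v hv l w hl hw
    by_cases hvT : v ∈ T
    · exact Or.inr (enterT v hvT l w (fun b hb hb' => hBU' b (hl hb) (hTU hb')) hw)
    · exact Or.inl (Or.inr ⟨v, [], l, w, rfl, hv, hvT, by simp, by simp, hl, hw⟩)
  refine ⟨S1 ∪ S2 ∪ S3, ?_, ?_⟩
  · rintro h ((⟨v, y, w, rfl, hv, hy, hw, hS⟩ | ⟨a, m, l, w, rfl, ha, haT, hm, hmr, hl, hw⟩) |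
      ⟨v, y, m, w, rfl, hv, hy, hm, hw, hS⟩)
    · obtain ⟨htr, v', r, he, -, hP, hO⟩ := hSB _ hS
      obtain ⟨rfl, rfl⟩ := List.cons.inj he
      have hvy : occ (v :: y) ⊆ B := by
        intro f hf
        rcases List.mem_cons.1 hf with rfl | hf
        · exact hv
        · exact hy hf
      refine ⟨fun F hF hFX => ?_, v, _, rfl, Or.inl hv, fun hvP => ?_, fun hvP u hu hE => ?_⟩
      · by_cases hFB : F ⊆ B
        · exact htr F hF hFB
        · exact hw.not_triple_of_subset (m := []) hv hy (by simp) hF hFX hFB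
      · obtain ⟨u, hu, hE, hs⟩ := hP hvP
        exact ⟨u, Or.inl hu, hE, Or.inl (Or.inl ⟨u, v :: y, w, rfl, hu, hvy, hw, hs⟩)⟩
      · rcases hu with hu | hu
        · exact Or.inl (Or.inl ⟨u, v :: y, w, rfl, hu, hvy, hw, hO hvP u hu hE⟩)
        · exact enterU u hu (v :: y) w hvy hw
    · have step : ∀ u ∈ U, rk u < rk a → u :: a :: (m ++ (l ++ w)) ∈ S1 ∪ S2 ∪ S3 := by
        intro u hu hr
        by_cases huT : u ∈ T
        · have := enterT u huT (a :: (m ++ l)) w (by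
            intro b hb
            simp only [List.mem_cons, List.mem_append] at hb
            rcases hb with rfl | hb | hb
            · exact haT
            · exact (hm b hb).2
            · exact fun hb' => hBU' b (hl hb) (hTU hb')) hw
          exact Or.inr (by simpa using this)
        · refine Or.inl (Or.inr ⟨u, a :: m, l, w, rfl, hu, huT, ?_, ?_, hl, hw⟩)
          · intro b hb
            rcases List.mem_cons.1 hb with rfl | hb
            · exact ⟨ha, haT⟩
            · exact hm b hb
          · intro b hb
            rcases List.mem_cons.1 hb with rfl | hb
            · exact hr
            · exact hr.trans (hmr b hb)
      refine ⟨fun F hF hFX => hw.not_triple_of_path hmr (fun h => hBU' a (hl h) ha) hF hFX,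
        a, _, rfl, Or.inr ha, fun haP => ?_, fun haP u hu hE => ?_⟩
      · obtain ⟨u, hu, hE, hr⟩ := (hrk a ha haT).1 haP
        exact ⟨u, Or.inr hu, hE, step u hu hr⟩
      · obtain ⟨hu', hr⟩ := (hrk a ha haT).2 haP u hu hE
        exact step u hu' hr
    · obtain ⟨htr, v', r, he, -, hP, hO⟩ := hST _ hS
      obtain ⟨rfl, rfl⟩ := List.cons.inj he
      have hvy : occ (v :: y) ⊆ T := by
        intro f hf
        rcases List.mem_cons.1 hf with rfl | hf
        · exact hv
        · exact hy hf
      refine ⟨fun F hF hFX => ?_, v, _, rfl, Or.inr (hTU hv), fun hvP => ?_,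
        fun hvP u hu hE => ?_⟩
      · by_cases hFT : F ⊆ T
        · exact htr F hF hFT
        · exact hw.not_triple_of_subset hv hy hm hF hFX hFT
      · obtain ⟨u, hu, hE, hs⟩ := hP hvP
        exact ⟨u, Or.inr (hTU hu), hE, Or.inr ⟨u, v :: y, m, w, rfl, hu, hvy, hm, hw, hs⟩⟩
      · have huT := (hcl v hv).2 hvP u hu hE
        exact Or.inr ⟨u, v :: y, m, w, rfl, huT, hvy, hm, hw, hO hvP u huT hE⟩
  · rintro w hw v (hv | hv)
    · exact Or.inl (Or.inl ⟨v, [], w, rfl, hv, by simp [occ], hw,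
        hiB w (hw.mono Set.subset_union_left) v hv⟩)
    · exact enterU v hv [] w (by simp [occ]) hw

/-- If `X` itself is harmless and the player owning `P` can play boundedly on the complement of
her attractor of `X \ C` for each proper subset `C`, then she can play boundedly on `X`. -/
lemma good_of_forall_ssubset {E : V → V → Prop} {P : Set V} {𝓕 : Set (Set V)} {X : Set V}
    (hX : X ∉ 𝓕) (hsub : ∀ v ∈ X, ∃ u ∈ X, E v u)
    (h : ∀ C ⊂ X, ∃ (U : Set V) (rk : V → ℕ), X \ C ⊆ U ∧ U ⊆ X ∧
      Ranked E P X (X \ C) U rk ∧ Good E P 𝓕 (X \ U)) : Good E P 𝓕 X := by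
  choose! U rk hCU hUX hrk hG using h
  choose! SC hSC hiC using hG
  let Cover : Set V → List V → Prop := fun C w =>
    C ⊂ X ∧ ∀ F ∈ 𝓕, F ⊆ X → ∀ s, s <+: w → occ s ⊆ F → occ s ⊆ C
  let S1 : Set (List V) := {h | ∃ v r, h = v :: r ∧ v ∈ X ∧ Unburdened 𝓕 X h}
  let S2 : Set (List V) := {h | ∃ C v y w, h = v :: (y ++ w) ∧ v ∈ X \ U C ∧
    occ y ⊆ X \ U C ∧ Unburdened 𝓕 X w ∧ Cover C w ∧ h ∈ SC C}
  let S3 : Set (List V) := {h | ∃ C a m l w, h = a :: (m ++ (l ++ w)) ∧ a ∈ U C ∧ a ∈ C ∧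
    occ m ⊆ C ∧ (∀ b ∈ m, rk C a < rk C b) ∧ occ l ⊆ X \ U C ∧ Unburdened 𝓕 X w ∧ Cover C w}
  have hTC : ∀ C ⊂ X, X \ U C ⊆ C := fun C hC v hv => by
    by_contra hvC
    exact hv.2 (hCU C hC ⟨hv.1, hvC⟩)
  have enterU : ∀ C w, Unburdened 𝓕 X w → Cover C w → ∀ l, occ l ⊆ X \ U C → ∀ v ∈ U C,
      v :: (l ++ w) ∈ S1 ∪ S2 ∪ S3 := by
    intro C w hw hC l hl v hv
    by_cases hvC : v ∈ C
    · exact Or.inr ⟨C, v, [], l, w, rfl, hv, hvC, by simp [occ], by simp, hl, hw, hC⟩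
    · exact Or.inl (Or.inl ⟨v, _, rfl, hUX C hC.1 hv,
        unburdened_of_exit hC.2 (hl.trans (hTC C hC.1)) hvC⟩)
  have enter : ∀ w, Unburdened 𝓕 X w → ∀ v ∈ X, v :: w ∈ S1 ∪ S2 ∪ S3 := by
    intro w hw v hv
    obtain ⟨C, hC⟩ : ∃ C, Cover C w := exists_cover hX ⟨v, hv⟩ w
    by_cases hvU : v ∈ U C
    · exact enterU C w hw hC [] (by simp [occ]) v hvU
    · exact Or.inl (Or.inr ⟨C, v, [], w, rfl, ⟨hv, hvU⟩, by simp [occ], hw, hC,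
        hiC C hC.1 w (hw.mono Set.sdiff_subset) v ⟨hv, hvU⟩⟩)
  refine ⟨S1 ∪ S2 ∪ S3, ?_, enter⟩
  rintro h ((⟨v, r, rfl, hv, hb⟩ | ⟨C, v, y, w, rfl, hv, hy, hw, hC, hS⟩) |
    ⟨C, a, m, l, w, rfl, ha, haC, hm, hmr, hl, hw, hC⟩)
  · refine ⟨fun F hF hFX => hb.not_triple hF hFX, v, r, rfl, hv, fun _ => ?_,
      fun _ u hu _ => enter _ hb u hu⟩
    obtain ⟨u, hu, hE⟩ := hsub v hv
    exact ⟨u, hu, hE, enter _ hb u hu⟩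
  · obtain ⟨htr, v', r, he, -, hP, hO⟩ := hSC C hC.1 _ hS
    obtain ⟨rfl, rfl⟩ := List.cons.inj he
    have hvy : occ (v :: y) ⊆ X \ U C := by
      intro f hf
      rcases List.mem_cons.1 hf with rfl | hf
      · exact hv
      · exact hy hf
    refine ⟨fun F hF hFX => ?_, v, _, rfl, hv.1, fun hvP => ?_, fun hvP u hu hE => ?_⟩
    · by_cases hFY : F ⊆ X \ U C
      · exact htr F hF hFY
      · exact hw.not_triple_of_subset (m := []) hv hy (by simp) hF hFX hFY
    · obtain ⟨u, hu, hE, hs⟩ := hP hvP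
      exact ⟨u, hu.1, hE, Or.inl (Or.inr ⟨C, u, v :: y, w, rfl, hu, hvy, hw, hC, hs⟩)⟩
    · by_cases huU : u ∈ U C
      · exact enterU C w hw hC (v :: y) hvy u huU
      · exact Or.inl (Or.inr ⟨C, u, v :: y, w, rfl, ⟨hu, huU⟩, hvy, hw, hC,
          hO hvP u ⟨hu, huU⟩ hE⟩)
  · have ham : occ (a :: m) ⊆ C := by
      intro f hf
      rcases List.mem_cons.1 hf with rfl | hf
      · exact haC
      · exact hm hf
    have step : ∀ u ∈ U C, rk C u < rk C a →
        u :: a :: (m ++ (l ++ w)) ∈ S1 ∪ S2 ∪ S3 := by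
      intro u hu hr
      by_cases huC : u ∈ C
      · refine Or.inr ⟨C, u, a :: m, l, w, rfl, hu, huC, ham, ?_, hl, hw, hC⟩
        intro b hb
        rcases List.mem_cons.1 hb with rfl | hb
        · exact hr
        · exact hr.trans (hmr b hb)
      · refine Or.inl (Or.inl ⟨u, _, rfl, hUX C hC.1 hu, ?_⟩)
        have : Unburdened 𝓕 X (u :: ((a :: m ++ l) ++ w)) := by
          refine unburdened_of_exit hC.2 ?_ huC
          intro f hf
          rcases List.mem_append.1 hf with hf | hf
          · exact ham hf
          · exact hTC C hC.1 (hl hf)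
        simpa using this
    have hk := hrk C hC.1 a ha (fun h => h.2 haC)
    refine ⟨fun F hF hFX => hw.not_triple_of_path hmr (fun h => (hl h).2 ha) hF hFX,
      a, _, rfl, hUX C hC.1 ha, fun haP => ?_, fun haP u hu hE => ?_⟩
    · obtain ⟨u, hu, hE, hr⟩ := hk.1 haP
      exact ⟨u, hUX C hC.1 hu, hE, step u hu hr⟩
    · obtain ⟨hu', hr⟩ := hk.2 haP u hu hE
      exact step u hu' hr

lemma determined_of_not_mem [Finite V] {E : V → V → Prop} {P : Set V} {𝓐 𝓑 : Set (Set V)}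
    {X : Set V} (hX : X ∉ 𝓑) (hsub : ∀ v ∈ X, ∃ u ∈ X, E v u)
    (ih : ∀ Y ⊂ X, (∀ v ∈ Y, ∃ u ∈ Y, E v u) → Determined E P 𝓐 𝓑 Y) :
    Determined E P 𝓐 𝓑 X := by
  have hsubU : ∀ (Q U : Set V), (∀ v ∈ X, v ∉ U → (v ∈ Q → ∀ u ∈ X, E v u → u ∉ U) ∧
      (v ∉ Q → ∃ u ∈ X, u ∉ U ∧ E v u)) → ∀ v ∈ X \ U, ∃ u ∈ X \ U, E v u := by
    intro Q U h v hv
    by_cases hvQ : v ∈ Q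
    · obtain ⟨u, hu, hE⟩ := hsub v hv.1
      exact ⟨u, ⟨hu, (h v hv.1 hv.2).1 hvQ u hu hE⟩, hE⟩
    · obtain ⟨u, hu, huU, hE⟩ := (h v hv.1 hv.2).2 hvQ
      exact ⟨u, ⟨hu, huU⟩, hE⟩
  by_cases hT : ∃ T ⊆ X, T.Nonempty ∧ ClosedFor E Pᶜ X T ∧ Good E Pᶜ 𝓐 T
  · obtain ⟨T, hTX, ⟨t, ht⟩, hcl, hG⟩ := hT
    obtain ⟨U, rk, hTU, hUX, hrk, hout⟩ := exists_attractor E Pᶜ X T hTX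
    obtain ⟨A, B, hAB, hd, hA, hB, gA, gB⟩ := ih (X \ U)
      (Set.sdiff_subset.ssubset_of_mem_notMem (hTX ht) (fun h => h.2 (hTU ht)))
      (hsubU _ _ hout)
    have hAX : A ⊆ X \ U := hAB ▸ Set.subset_union_left
    have hBX : B ⊆ X \ U := hAB ▸ Set.subset_union_right
    have hBUX : B ∪ U ⊆ X := Set.union_subset (hBX.trans Set.sdiff_subset) hUX
    refine ⟨A, B ∪ U, ?_, ?_, ?_, ?_, gA, ?_⟩
    · rw [← Set.union_assoc, hAB, Set.sdiff_union_of_subset hUX]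
    · exact Set.disjoint_union_right.2 ⟨hd, Set.disjoint_left.2 fun v hv => (hAX hv).2⟩
    · intro v hv
      refine ⟨(hA v hv).1, fun hvP u hu hE => (hA v hv).2 hvP u ⟨hu, ?_⟩ hE⟩
      exact (hout v (hAX hv).1 (hAX hv).2).1 hvP u hu hE
    · rintro v (hv | hv)
      · refine ⟨fun hvP => ?_, fun hvP u hu hE => ?_⟩
        · obtain ⟨u, hu, hE⟩ := (hB v hv).1 hvP
          exact ⟨u, Or.inl hu, hE⟩
        · by_cases huU : u ∈ U
          · exact Or.inr huU
          · exact Or.inl ((hB v hv).2 hvP u ⟨hu, huU⟩ hE)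
      · by_cases hvT : v ∈ T
        · refine ⟨fun hvP => ?_, fun hvP u hu hE =>
            Or.inr (hTU ((hcl v hvT).2 hvP u hu hE))⟩
          obtain ⟨u, hu, hE⟩ := (hcl v hvT).1 hvP
          exact ⟨u, Or.inr (hTU hu), hE⟩
        · refine ⟨fun hvP => ?_, fun hvP u hu hE =>
            Or.inr ((hrk v hv hvT).2 hvP u hu hE).1⟩
          obtain ⟨u, hu, hE, -⟩ := (hrk v hv hvT).1 hvP
          exact ⟨u, Or.inr hu, hE⟩
    · refine gB.union_attractor (rk := rk) hG hTU (Set.disjoint_left.2 fun v hv => (hBX hv).2)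
        ?_ ?_
      · exact fun v hv => ⟨(hcl v hv).1, fun hvP u hu => (hcl v hv).2 hvP u (hBUX hu)⟩
      · exact fun v hv hvT =>
          ⟨(hrk v hv hvT).1, fun hvP u hu => (hrk v hv hvT).2 hvP u (hBUX hu)⟩
  · refine ⟨X, ∅, by simp, by simp, ?_, ?_, ?_, ∅, ?_, ?_⟩
    · exact fun v hv => ⟨fun _ => hsub v hv, fun _ u hu _ => hu⟩
    · exact fun v hv => absurd hv (Set.notMem_empty v)
    · refine good_of_forall_ssubset hX hsub fun C hC => ?_
      obtain ⟨U, rk, hCU, hUX, hrk, hout⟩ := exists_attractor E P X (X \ C) Set.sdiff_subset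
      refine ⟨U, rk, hCU, hUX, hrk, ?_⟩
      obtain ⟨t, ht, htC⟩ := Set.exists_of_ssubset hC
      obtain ⟨A, B, hAB, hd, hA, hB, gA, gB⟩ := ih (X \ U)
        (Set.sdiff_subset.ssubset_of_mem_notMem ht (fun h => h.2 (hCU ⟨ht, htC⟩)))
        (hsubU _ _ hout)
      have hBX : B ⊆ X \ U := hAB ▸ Set.subset_union_right
      have hBe : B = ∅ := by
        by_contra hne
        refine hT ⟨B, hBX.trans Set.sdiff_subset, Set.nonempty_iff_ne_empty.2 hne, ?_, gB⟩
        intro v hv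
        refine ⟨(hB v hv).1, fun hvP u hu hE => (hB v hv).2 hvP u ⟨hu, ?_⟩ hE⟩
        exact (hout v (hBX hv).1 (hBX hv).2).1 (by simpa using hvP) u hu hE
      rw [hBe, Set.union_empty] at hAB
      rwa [← hAB]
    · exact fun h hh => absurd hh (Set.notMem_empty h)
    · exact fun w _ v hv => absurd hv (Set.notMem_empty v)

lemma determined [Finite V] (E : V → V → Prop) (P : Set V) {𝓐 𝓑 : Set (Set V)}
    (hdisj : Disjoint 𝓐 𝓑) (X : Set V) (hsub : ∀ v ∈ X, ∃ u ∈ X, E v u) :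
    Determined E P 𝓐 𝓑 X := by
  induction X using (Finite.to_wellFoundedLT (α := Set V)).induction with
  | _ X ih =>
    by_cases hX : X ∈ 𝓑
    · refine (determined_of_not_mem (Set.disjoint_right.1 hdisj hX) hsub ?_).symm
      intro Y hY hs
      exact Determined.symm (by rw [compl_compl]; exact ih Y hY hs)
    · exact determined_of_not_mem hX hsub ih

lemma exists_segment [Finite V] {ρ : ℕ → V} {N : ℕ} (hN : ∀ n, N ≤ n → ρ n ∈ limitSet ρ)
    (M : ℕ) (hM : N ≤ M) : ∃ k, occ ((List.range' M k).map ρ) = limitSet ρ := by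
  have h : ∀ v : V, ∃ n, v ∈ limitSet ρ → M ≤ n ∧ ρ n = v := by
    intro v
    by_cases hv : v ∈ limitSet ρ
    · obtain ⟨n, hn⟩ := hv M
      exact ⟨n, fun _ => hn⟩
    · exact ⟨0, fun h => absurd h hv⟩
  choose f hf using h
  obtain ⟨K, hK⟩ := (Set.finite_range f).bddAbove
  refine ⟨K + 1, Set.Subset.antisymm ?_ ?_⟩
  · intro v hv
    obtain ⟨n, hn, rfl⟩ := List.mem_map.1 hv
    exact hN n (hM.trans (List.mem_range'_1.1 hn).1)
  · intro v hv
    obtain ⟨h1, h2⟩ := hf v hv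
    refine List.mem_map.2 ⟨f v, List.mem_range'_1.2 ⟨h1, ?_⟩, h2⟩
    have := hK ⟨v, rfl⟩
    omega

lemma exists_triple_limitSet [Finite V] (ρ : ℕ → V) :
    ∃ n, Triple (limitSet ρ) ((List.range (n + 1)).map ρ).reverse := by
  have hex : ∃ N, ∀ n, N ≤ n → ρ n ∈ limitSet ρ := by
    have h : ∀ v : V, ∃ N, v ∉ limitSet ρ → ∀ n, N ≤ n → ρ n ≠ v := by
      intro v
      by_cases hv : v ∈ limitSet ρ
      · exact ⟨0, fun h => absurd hv h⟩
      · simp only [limitSet, Set.mem_ofPred_eq] at hv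
        push Not at hv
        obtain ⟨N, hN⟩ := hv
        exact ⟨N, fun _ => hN⟩
    choose f hf using h
    obtain ⟨K, hK⟩ := (Set.finite_range f).bddAbove
    exact ⟨K, fun n hn => by_contra fun hc => hf _ hc n ((hK ⟨_, rfl⟩).trans hn) rfl⟩
  obtain ⟨N, hN⟩ := hex
  have hne : (limitSet ρ).Nonempty := ⟨ρ N, hN N le_rfl⟩
  obtain ⟨a, ha⟩ := exists_segment hN N le_rfl
  obtain ⟨b, hb⟩ := exists_segment hN (N + a) (by omega)
  obtain ⟨c, hc⟩ := exists_segment hN (N + a + b) (by omega)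
  have hrev : ∀ x : List V, occ x.reverse = occ x := fun x => by ext; simp [occ]
  have hc0 : c ≠ 0 := by
    rintro rfl
    rw [← hc] at hne
    simp [occ] at hne
  refine ⟨N + a + b + c - 1, hne, _, _, _, ((List.range' 0 N).map ρ).reverse,
    (hrev _).trans hc, (hrev _).trans hb, (hrev _).trans ha, ?_⟩
  have : N + a + b + c - 1 + 1 = N + (a + (b + c)) := by omega
  rw [this, List.range_eq_range', ← List.range'_append_1, Nat.zero_add, ← List.range'_append_1,
    ← List.range'_append_1]
  simp only [List.map_append, List.reverse_append, List.append_assoc]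

lemma score_le_two_of_not_triple {F : Set V} {w : List V} (h : ¬ Triple F w.reverse) :
    score F w ≤ 2 := by
  apply csSup_le'
  rintro k ⟨xs, rfl, hxs, hw⟩
  by_contra hk
  have hlen : 3 ≤ xs.reverse.length := by rw [List.length_reverse]; omega
  have hrev : ∀ x : List V, occ x.reverse = occ x := fun x => by ext; simp [occ]
  obtain ⟨x, y, z, t, he⟩ : ∃ x y z t, xs.reverse = x :: y :: z :: t := by
    match xs.reverse, hlen with
    | x :: y :: z :: t, _ => exact ⟨x, y, z, t, rfl⟩
  have hmem : ∀ l ∈ x :: y :: z :: t, l ≠ [] ∧ occ l = F := fun l hl =>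
    hxs l (List.mem_reverse.1 (he ▸ hl))
  have hx := hmem x (by simp)
  have hxs' : xs = t.reverse ++ [z, y, x] := by
    rw [← List.reverse_reverse xs, he]; simp
  obtain ⟨s, rfl⟩ := hw
  refine h ⟨?_, x.reverse, y.reverse, z.reverse, (t.reverse.flatten).reverse ++ s.reverse,
    (hrev _).trans hx.2, (hrev _).trans (hmem y (by simp)).2,
    (hrev _).trans (hmem z (by simp)).2, ?_⟩
  · obtain ⟨v, hv⟩ := List.exists_mem_of_ne_nil x hx.1
    exact ⟨v, hx.2 ▸ hv⟩
  · rw [hxs']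
    simp

/-- A legal strategy bounding the scores on all of `A`. -/
lemma Good.exists_strategy {G : Arena V} {P : Set V} {𝓕 : Set (Set V)} {A : Set V}
    (hG : Good G.E P 𝓕 A) (hcl : ClosedFor G.E P Set.univ A) :
    ∃ σ : Strategy V, G.Legal σ ∧ ∀ ρ : ℕ → V, ρ 0 ∈ A → (∀ n, G.E (ρ n) (ρ (n + 1))) →
      (∀ n, ρ n ∈ P → ρ (n + 1) = σ ((List.range n).map ρ) (ρ n)) →
      ∀ F ∈ 𝓕, ∀ n, ¬ Triple F ((List.range (n + 1)).map ρ).reverse := by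
  classical
  obtain ⟨S, hS, hi⟩ := hG
  have hex : ∀ (w : List V) (v : V), ∃ u, G.E v u ∧
      ((∃ u ∈ A, G.E v u ∧ u :: v :: w.reverse ∈ S) → u ∈ A ∧ u :: v :: w.reverse ∈ S) := by
    intro w v
    by_cases h : ∃ u ∈ A, G.E v u ∧ u :: v :: w.reverse ∈ S
    · obtain ⟨u, hu, hE, hs⟩ := h
      exact ⟨u, hE, fun _ => ⟨hu, hs⟩⟩
    · obtain ⟨u, hE⟩ := G.exists_succ v
      exact ⟨u, hE, fun h' => absurd h' h⟩
  choose σ hσE hσ using hex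
  refine ⟨σ, hσE, fun ρ h0 hE hcons => ?_⟩
  have key : ∀ n, ρ n ∈ A ∧ ((List.range (n + 1)).map ρ).reverse ∈ S := by
    intro n
    induction n with
    | zero => exact ⟨h0, by simpa using hi [] (unburdened_nil _ _) _ h0⟩
    | succ n ih =>
      obtain ⟨hA, hs⟩ := ih
      have hrw : ((List.range (n + 1)).map ρ).reverse =
          ρ n :: ((List.range n).map ρ).reverse := by
        simp [List.range_succ, -List.map_reverse]
      have hrw' : ((List.range (n + 1 + 1)).map ρ).reverse =
          ρ (n + 1) :: ((List.range (n + 1)).map ρ).reverse := by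
        rw [List.range_succ]; simp [-List.map_reverse]
      obtain ⟨-, v, r, he, -, hP, hO⟩ := hS _ hs
      obtain ⟨rfl, rfl⟩ := List.cons.inj (hrw.symm.trans he)
      rw [hrw']
      by_cases hp : ρ n ∈ P
      · rw [hcons n hp, hrw]
        rw [hrw] at hP
        exact hσ _ _ (hP hp)
      · have hu := (hcl _ hA).2 hp _ (Set.mem_univ _) (hE n)
        exact ⟨hu, hO hp _ hu (hE n)⟩
  intro F hF n htr
  refine (hS _ (key n).2).1 F hF ?_ htr
  obtain ⟨-, x, y, z, r, hx, -, -, he⟩ := htr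
  intro f hf
  rw [← hx] at hf
  have : f ∈ ((List.range (n + 1)).map ρ).reverse := by
    rw [he]; simp [mem_occ.1 hf]
  obtain ⟨m, -, rfl⟩ := List.mem_map.1 (List.mem_reverse.1 this)
  exact (key m).1

lemma playList_eq (G : Arena V) (i : Fin 2) (σ τ : Strategy V) (v : V) (n : ℕ) :
    playList G i σ τ v n = (List.range (n + 1)).map (playOf G i σ τ v) := by
  induction n with
  | zero => simp [playList, playOf]
  | succ n ih =>
    rw [List.range_succ, List.map_append, ← ih]
    simp [playOf, playList]

open Classical in
lemma playOf_succ (G : Arena V) (i : Fin 2) (σ τ : Strategy V) (v : V) (n : ℕ) :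
    playOf G i σ τ v (n + 1) =
      if playOf G i σ τ v n ∈ G.pos i
      then σ ((List.range n).map (playOf G i σ τ v)) (playOf G i σ τ v n)
      else τ ((List.range n).map (playOf G i σ τ v)) (playOf G i σ τ v n) := by
  have h : (playList G i σ τ v n).dropLast = (List.range n).map (playOf G i σ τ v) := by
    rw [playList_eq, List.range_succ]; simp
  conv_lhs => rw [playOf, playList]
  simp [playOf, h]

lemma playOf_edge {G : Arena V} {i : Fin 2} {σ τ : Strategy V} (hσ : G.Legal σ)
    (hτ : G.Legal τ) (v : V) (n : ℕ) :
    G.E (playOf G i σ τ v n) (playOf G i σ τ v (n + 1)) := by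
  rw [playOf_succ]
  split_ifs
  · exact hσ _ _
  · exact hτ _ _

lemma exists_strategy_score_le_two [Finite V] (G : Arena V) (𝓐 𝓑 : Set (Set V))
    (hpart : 𝓐 ∪ 𝓑 = Set.univ) (hdisj : Disjoint 𝓐 𝓑) (i : Fin 2) :
    ∃ σ : Strategy V, G.Legal σ ∧ ∀ v ∈ G.MullerWinRegion i 𝓐,
      (∀ ρ : ℕ → V, G.IsPlay v ρ → G.ConsistentInf i σ ρ → limitSet ρ ∈ 𝓐) ∧
      ∀ τ : Strategy V, G.Legal τ → maxscoreInf 𝓑 (playOf G i σ τ v) ≤ 2 := by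
  obtain ⟨A, B, hAB, -, hA, hB, gA, gB⟩ := determined G.E (G.pos i) hdisj Set.univ
    (fun v _ => by simpa using G.exists_succ v)
  obtain ⟨σ, hσ, hσA⟩ := gA.exists_strategy hA
  obtain ⟨τ, hτ, hτB⟩ := gB.exists_strategy hB
  refine ⟨σ, hσ, fun v hv => ?_⟩
  have hvA : v ∈ A := by
    by_contra hvA
    have hvB : v ∈ B := by
      have : v ∈ A ∪ B := hAB ▸ Set.mem_univ v
      exact this.resolve_left hvA
    obtain ⟨σ', hσ', hwin⟩ := hv
    obtain ⟨n, hn⟩ := exists_triple_limitSet (playOf G i σ' τ v)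
    refine hτB (playOf G i σ' τ v) hvB (playOf_edge hσ' hτ v) ?_ _ (hwin _
      ⟨rfl, playOf_edge hσ' hτ v⟩ ?_) n hn
    · intro m hm
      rw [playOf_succ, if_neg hm]
    · intro m hm
      rw [playOf_succ, if_pos hm]
  constructor
  · rintro ρ ⟨rfl, hE⟩ hcons
    obtain ⟨n, hn⟩ := exists_triple_limitSet ρ
    have : limitSet ρ ∈ 𝓐 ∪ 𝓑 := hpart ▸ Set.mem_univ _
    exact this.resolve_right fun h => hσA ρ hvA hE hcons _ h n hn
  · intro τ' hτ'
    refine iSup₂_le fun F hF => iSup_le fun n => ?_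
    have := hσA (playOf G i σ τ' v) hvA (playOf_edge hσ hτ' v)
      (fun m hm => by rw [playOf_succ, if_pos hm]) F hF n
    exact_mod_cast score_le_two_of_not_triple this

/-- In a Muller game `(G, 𝓕₀, 𝓕₁)`, each Player `i` has a
winning strategy `σ` for her winning region `W_i` such that
`maxscore_{𝓕_{1-i}}(play(v, σ, τ)) ≤ 2` for every vertex `v ∈ W_i` and every
strategy `τ` of Player `1 - i`. -/
theorem stmt_12 {V : Type u} [Fintype V] (G : Arena V)
    (F0 F1 : Set (Set V)) (hpart : F0 ∪ F1 = Set.univ) (hdisj : Disjoint F0 F1)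
    (i : Fin 2) :
    ∃ σ : Strategy V, G.Legal σ ∧
      ∀ v ∈ G.MullerWinRegion i (if i = 0 then F0 else F1),
        (∀ ρ : ℕ → V, G.IsPlay v ρ → G.ConsistentInf i σ ρ →
          limitSet ρ ∈ (if i = 0 then F0 else F1)) ∧
        ∀ τ : Strategy V, G.Legal τ →
          maxscoreInf (if i = 0 then F1 else F0) (playOf G i σ τ v) ≤ 2 := by
  fin_cases i
  · exact exists_strategy_score_le_two G F0 F1 hpart hdisj 0
  · exact exists_strategy_score_le_two G F1 F0 (by rw [Set.union_comm, hpart]) hdisj.symm 1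
end
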